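/- arXiv:math/0703643 — 7 statements merged into one kernel-verified Lean document; each statement's English description precedes it below -/
import Mathlib

section
/- Let R be a commutative ring, C a semidualizing R-module, and M an R-module. If X⁺ is an augmented proper P_C-projective resolution of M, then the complex Hom_R(C, X⁺) is an augmented projective resolution of Hom_R(C,M); that is, Hom_R(C, X⁺) is exact and each module Hom_R(C, C ⊗_R P_i) is projective. -/
open TensorProduct CategoryTheory

noncomputable section

/-- The natural evaluation map `ν_M : C ⊗_R Hom_R(C,M) → M`, `c ⊗ f ↦ f c`. -/
def evalNu (R : Type) [CommRing R] (C : Type) [AddCommGroup C] [Module R C]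
    (M : Type) [AddCommGroup M] [Module R M] :
    (C ⊗[R] (C →ₗ[R] M)) →ₗ[R] M :=
  TensorProduct.lift LinearMap.applyₗ

/-- The natural map `μ_M : M → Hom_R(C, C ⊗_R M)`, `m ↦ (c ↦ c ⊗ m)`. -/
def muMap (R : Type) [CommRing R] (C : Type) [AddCommGroup C] [Module R C]
    (M : Type) [AddCommGroup M] [Module R M] :
    M →ₗ[R] (C →ₗ[R] (C ⊗[R] M)) :=
  (TensorProduct.mk R C M).flip

/-- `Ext^i_R(A,B)`. -/
def extMod (R : Type) [CommRing R] (A : Type) [AddCommGroup A] [Module R A]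
    (B : Type) [AddCommGroup B] [Module R B] (i : ℕ) : ModuleCat R :=
  ((Ext R (ModuleCat R) i).obj (Opposite.op (ModuleCat.of R A))).obj (ModuleCat.of R B)

/-- `Tor_i^R(A,B)`. -/
def torMod (R : Type) [CommRing R] (A : Type) [AddCommGroup A] [Module R A]
    (B : Type) [AddCommGroup B] [Module R B] (i : ℕ) : ModuleCat R :=
  ((Tor (ModuleCat R) i).obj (ModuleCat.of R A)).obj (ModuleCat.of R B)

/-- A semidualizing module: `C` admits a degreewise finite projective resolution,
the homothety map `R → Hom_R(C,C)` is bijective, and `Ext^i_R(C,C) = 0` for `i ≥ 1`. -/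
def IsSemidualizing (R : Type) [CommRing R] (C : Type) [AddCommGroup C] [Module R C] :
    Prop :=
  (∃ (P : ℕ → ModuleCat.{0} R) (d : ∀ n, ↥(P (n + 1)) →ₗ[R] ↥(P n)) (ε : ↥(P 0) →ₗ[R] C),
      (∀ n, Module.Finite R ↥(P n)) ∧ (∀ n, Module.Projective R ↥(P n)) ∧
      Function.Surjective ε ∧ Function.Exact (d 0) ε ∧
      ∀ n, Function.Exact (d (n + 1)) (d n)) ∧
  Function.Bijective (fun r : R => (r • LinearMap.id : C →ₗ[R] C)) ∧
  ∀ i : ℕ, 1 ≤ i → Subsingleton (extMod R C C i)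

/-- The Bass class `B_C`. -/
def MemBassClass (R : Type) [CommRing R] (C : Type) [AddCommGroup C] [Module R C]
    (M : Type) [AddCommGroup M] [Module R M] : Prop :=
  (∀ i : ℕ, 1 ≤ i → Subsingleton (extMod R C M i)) ∧
  (∀ i : ℕ, 1 ≤ i → Subsingleton (torMod R C (C →ₗ[R] M) i)) ∧
  Function.Bijective (evalNu R C M)

/-- The Auslander class `A_C`. -/
def MemAuslanderClass (R : Type) [CommRing R] (C : Type) [AddCommGroup C] [Module R C]
    (M : Type) [AddCommGroup M] [Module R M] : Prop :=
  (∀ i : ℕ, 1 ≤ i → Subsingleton (torMod R C M i)) ∧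
  (∀ i : ℕ, 1 ≤ i → Subsingleton (extMod R C (C ⊗[R] M) i)) ∧
  Function.Bijective (muMap R C M)

/-- `X⁺ : ⋯ → C ⊗ P₁ → C ⊗ P₀ → M → 0` is an augmented proper `P_C`-projective resolution:
each `Pᵢ` is projective, it is a complex, and `Hom_R(C ⊗ Q, X⁺)` is exact for each
projective module `Q`. -/
def IsAugProperRes (R : Type) [CommRing R] (C : Type) [AddCommGroup C] [Module R C]
    (M : Type) [AddCommGroup M] [Module R M] (P : ℕ → ModuleCat.{0} R)
    (d : ∀ n : ℕ, (C ⊗[R] ↥(P (n + 1))) →ₗ[R] (C ⊗[R] ↥(P n)))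
    (ε : (C ⊗[R] ↥(P 0)) →ₗ[R] M) : Prop :=
  (∀ n, Module.Projective R ↥(P n)) ∧
  (∀ n, (d n).comp (d (n + 1)) = 0) ∧ (ε.comp (d 0) = 0) ∧
  ∀ (Q : Type) [AddCommGroup Q] [Module R Q], Module.Projective R Q →
    Function.Surjective (fun g : (C ⊗[R] Q) →ₗ[R] (C ⊗[R] ↥(P 0)) => ε.comp g) ∧
    Function.Exact (fun g : (C ⊗[R] Q) →ₗ[R] (C ⊗[R] ↥(P 1)) => (d 0).comp g)
      (fun g : (C ⊗[R] Q) →ₗ[R] (C ⊗[R] ↥(P 0)) => ε.comp g) ∧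
    ∀ n : ℕ, Function.Exact
      (fun g : (C ⊗[R] Q) →ₗ[R] (C ⊗[R] ↥(P (n + 2))) => (d (n + 1)).comp g)
      (fun g : (C ⊗[R] Q) →ₗ[R] (C ⊗[R] ↥(P (n + 1))) => (d n).comp g)

/-- Exactness of the augmented complex `⋯ → C ⊗ P₁ → C ⊗ P₀ → M → 0`. -/
def ResExact (R : Type) [CommRing R] (C : Type) [AddCommGroup C] [Module R C]
    (M : Type) [AddCommGroup M] [Module R M] (P : ℕ → ModuleCat.{0} R)
    (d : ∀ n : ℕ, (C ⊗[R] ↥(P (n + 1))) →ₗ[R] (C ⊗[R] ↥(P n)))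
    (ε : (C ⊗[R] ↥(P 0)) →ₗ[R] M) : Prop :=
  Function.Surjective ε ∧ Function.Exact (d 0) ε ∧
    ∀ n : ℕ, Function.Exact (d (n + 1)) (d n)

/-- Exactness of the augmented complex in all degrees `< n`
(`C ⊗ Pᵢ` in degree `i`, `M` in degree `-1`). -/
def ResExactLT (R : Type) [CommRing R] (C : Type) [AddCommGroup C] [Module R C]
    (M : Type) [AddCommGroup M] [Module R M] (P : ℕ → ModuleCat.{0} R)
    (d : ∀ n : ℕ, (C ⊗[R] ↥(P (n + 1))) →ₗ[R] (C ⊗[R] ↥(P n)))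
    (ε : (C ⊗[R] ↥(P 0)) →ₗ[R] M) (n : ℕ) : Prop :=
  Function.Surjective ε ∧ (0 < n → Function.Exact (d 0) ε) ∧
    ∀ i : ℕ, i + 1 < n → Function.Exact (d (i + 1)) (d i)


/-- An exact sequence `0 → C ⊗ P_n → ⋯ → C ⊗ P_1 → C ⊗ P_0 → M → 0`
with each `P_i` projective (encoded by an `ℕ`-indexed complex which vanishes
in degrees `> n`). -/
def HasBoundedExactCRes (R : Type) [CommRing R] (C : Type) [AddCommGroup C] [Module R C]
    (M : Type) [AddCommGroup M] [Module R M] (n : ℕ) : Prop :=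
  ∃ (P : ℕ → ModuleCat.{0} R)
    (d : ∀ i : ℕ, (C ⊗[R] ↥(P (i + 1))) →ₗ[R] (C ⊗[R] ↥(P i)))
    (ε : (C ⊗[R] ↥(P 0)) →ₗ[R] M),
      (∀ i, Module.Projective R ↥(P i)) ∧ ResExact R C M P d ε ∧
      ∀ i, n < i → Subsingleton (C ⊗[R] ↥(P i))

/-- `M` has finite `P_C`-projective dimension. -/
def HasFinCPd (R : Type) [CommRing R] (C : Type) [AddCommGroup C] [Module R C]
    (M : Type) [AddCommGroup M] [Module R M] : Prop :=
  ∃ n : ℕ, HasBoundedExactCRes R C M n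

/-- `M` has projective dimension at most `n`: there is an exact sequence
`0 → Q_n → ⋯ → Q_0 → M → 0` with each `Q_i` projective. -/
def HasProjDimLE (R : Type) [CommRing R] (M : Type) [AddCommGroup M] [Module R M]
    (n : ℕ) : Prop :=
  ∃ (Q : ℕ → ModuleCat.{0} R) (d : ∀ i : ℕ, ↥(Q (i + 1)) →ₗ[R] ↥(Q i))
    (ε : ↥(Q 0) →ₗ[R] M),
      (∀ i, Module.Projective R ↥(Q i)) ∧ Function.Surjective ε ∧
      Function.Exact (d 0) ε ∧ (∀ i, Function.Exact (d (i + 1)) (d i)) ∧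
      ∀ i, n < i → Subsingleton ↥(Q i)

/-- `M` has injective dimension at most `n`: there is an exact sequence
`0 → M → I⁰ → ⋯ → Iⁿ → 0` with each `I^j` injective. -/
def HasInjDimLE (R : Type) [CommRing R] (M : Type) [AddCommGroup M] [Module R M]
    (n : ℕ) : Prop :=
  ∃ (I : ℕ → ModuleCat.{0} R) (δ : ∀ j : ℕ, ↥(I j) →ₗ[R] ↥(I (j + 1)))
    (ι : M →ₗ[R] ↥(I 0)),
      (∀ j, Module.Injective R ↥(I j)) ∧ Function.Injective ι ∧
      Function.Exact ι (δ 0) ∧ (∀ j, Function.Exact (δ j) (δ (j + 1))) ∧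
      ∀ j, n < j → Subsingleton ↥(I j)

/-- The natural map `R^(ι) → Hom(C, C^(ι))`. -/
def finsuppHom (R : Type) [CommRing R] (C : Type) [AddCommGroup C] [Module R C] (ι : Type) :
    (ι →₀ R) →ₗ[R] (C →ₗ[R] (ι →₀ C)) :=
  Finsupp.lsum R fun i => LinearMap.toSpanSingleton R _ (Finsupp.lsingle i : C →ₗ[R] (ι →₀ C))

theorem finsuppHom_apply (R : Type) [CommRing R] (C : Type) [AddCommGroup C] [Module R C]
    (ι : Type) (r : ι →₀ R) (c : C) (i : ι) : finsuppHom R C ι r c i = r i • c := by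
  classical
  induction r using Finsupp.induction_linear with
  | zero => simp
  | add f g hf hg => simp [hf, hg, add_smul]
  | single j a =>
    by_cases h : j = i
    · subst h; simp [finsuppHom]
    · simp [finsuppHom, h]

theorem finsuppHom_bijective (R : Type) [CommRing R] (C : Type) [AddCommGroup C] [Module R C]
    [Module.Finite R C]
    (h : Function.Bijective (fun r : R => (r • LinearMap.id : C →ₗ[R] C))) (ι : Type) :
    Function.Bijective (finsuppHom R C ι) := by
  classical
  constructor
  · intro r s hrs
    ext i
    apply h.1
    ext c
    have := congrArg (fun f => f c i) hrs
    simpa [finsuppHom_apply] using this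
  · intro f
    choose r hr using fun i => h.2 ((Finsupp.lapply i : (ι →₀ C) →ₗ[R] C) ∘ₗ f)
    have hr' : ∀ i c, r i • c = f c i := fun i c => by
      have := congrArg (fun f => f c) (hr i)
      simpa using this
    obtain ⟨S, hS⟩ := (Module.Finite.fg_top : (⊤ : Submodule R C).FG)
    have hsupp : ∀ i, r i ≠ 0 → i ∈ S.biUnion (fun c => (f c).support) := by
      intro i hi
      by_contra hn
      apply hi
      apply h.1
      apply LinearMap.ext_on (s := (S : Set C)) hS
      intro c hc
      have : f c i = 0 := by
        by_contra h0
        exact hn (Finset.mem_biUnion.2 ⟨c, hc, Finsupp.mem_support_iff.2 h0⟩)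
      simp [hr', this]
    refine ⟨Finsupp.onFinset _ r hsupp, ?_⟩
    ext c i
    rw [finsuppHom_apply, Finsupp.onFinset_apply, hr']

theorem projective_hom_tensor (R : Type) [CommRing R] (C : Type) [AddCommGroup C] [Module R C]
    [Module.Finite R C]
    (h : Function.Bijective (fun r : R => (r • LinearMap.id : C →ₗ[R] C)))
    (P : Type) [AddCommGroup P] [Module R P] (hP : Module.Projective R P) :
    Module.Projective R (C →ₗ[R] (C ⊗[R] P)) := by
  classical
  obtain ⟨s, hs⟩ := Module.projective_def'.1 hP
  have e : (P →₀ R) ≃ₗ[R] (C →ₗ[R] (C ⊗[R] (P →₀ R))) :=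
    (LinearEquiv.ofBijective _ (finsuppHom_bijective R C h P)).trans
      (LinearEquiv.congrRight (TensorProduct.finsuppScalarRight R R C P).symm)
  have : Module.Projective R (C →ₗ[R] (C ⊗[R] (P →₀ R))) := Module.Projective.of_equiv e
  refine Module.Projective.of_split
    (LinearMap.llcomp R C (C ⊗[R] P) (C ⊗[R] (P →₀ R)) (LinearMap.lTensor C s))
    (LinearMap.llcomp R C (C ⊗[R] (P →₀ R)) (C ⊗[R] P)
      (LinearMap.lTensor C (Finsupp.linearCombination R id))) ?_
  ext f c
  change LinearMap.lTensor C (Finsupp.linearCombination R id) (LinearMap.lTensor C s (f c)) = f c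
  rw [← LinearMap.comp_apply, ← LinearMap.lTensor_comp, hs, LinearMap.lTensor_id,
    LinearMap.id_apply]

theorem surjective_comp_of_equiv (R : Type) [CommRing R] {C D X Y : Type}
    [AddCommGroup C] [Module R C] [AddCommGroup D] [Module R D]
    [AddCommGroup X] [Module R X] [AddCommGroup Y] [Module R Y]
    (e : D ≃ₗ[R] C) (f : X →ₗ[R] Y)
    (h : Function.Surjective (fun g : D →ₗ[R] X => f.comp g)) :
    Function.Surjective (fun g : C →ₗ[R] X => f.comp g) := by
  intro y
  obtain ⟨g, hg⟩ := h (y ∘ₗ e.toLinearMap)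
  refine ⟨g ∘ₗ e.symm.toLinearMap, ?_⟩
  ext c
  have := congrArg (fun k => k (e.symm c)) hg
  simpa using this

theorem exact_comp_of_equiv (R : Type) [CommRing R] {C D X Y Z : Type}
    [AddCommGroup C] [Module R C] [AddCommGroup D] [Module R D]
    [AddCommGroup X] [Module R X] [AddCommGroup Y] [Module R Y] [AddCommGroup Z] [Module R Z]
    (e : D ≃ₗ[R] C) (f : X →ₗ[R] Y) (k : Y →ₗ[R] Z) (hkf : k.comp f = 0)
    (h : Function.Exact (fun g : D →ₗ[R] X => f.comp g) (fun g : D →ₗ[R] Y => k.comp g)) :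
    Function.Exact (fun g : C →ₗ[R] X => f.comp g) (fun g : C →ₗ[R] Y => k.comp g) := by
  intro y
  constructor
  · intro hy
    have hy' : k.comp y = 0 := hy
    obtain ⟨g, hg⟩ := (h (y ∘ₗ e.toLinearMap)).1 (by
      change k.comp (y.comp e.toLinearMap) = 0
      rw [← LinearMap.comp_assoc, hy', LinearMap.zero_comp])
    refine ⟨g ∘ₗ e.symm.toLinearMap, ?_⟩
    ext c
    have := congrArg (fun k => k (e.symm c)) hg
    simpa using this
  · rintro ⟨g, rfl⟩
    change k.comp (f.comp g) = 0
    rw [← LinearMap.comp_assoc, hkf, LinearMap.zero_comp]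

/-- If `X⁺` is an augmented proper `P_C`-projective resolution of `M`, then
`Hom_R(C, X⁺)` is an augmented projective resolution of `Hom_R(C,M)`: each
`Hom_R(C, C ⊗ P_i)` is projective and `Hom_R(C, X⁺)` is exact. -/
theorem homC_of_augProperRes_is_projectiveResolution
    (R : Type) [CommRing R] (C : Type) [AddCommGroup C] [Module R C]
    (M : Type) [AddCommGroup M] [Module R M] (hC : IsSemidualizing R C)
    (P : ℕ → ModuleCat.{0} R)
    (d : ∀ n : ℕ, (C ⊗[R] ↥(P (n + 1))) →ₗ[R] (C ⊗[R] ↥(P n)))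
    (ε : (C ⊗[R] ↥(P 0)) →ₗ[R] M)
    (hX : IsAugProperRes R C M P d ε) :
    (∀ n, Module.Projective R (C →ₗ[R] (C ⊗[R] ↥(P n)))) ∧
    Function.Surjective (fun g : C →ₗ[R] (C ⊗[R] ↥(P 0)) => ε.comp g) ∧
    Function.Exact (fun g : C →ₗ[R] (C ⊗[R] ↥(P 1)) => (d 0).comp g)
      (fun g : C →ₗ[R] (C ⊗[R] ↥(P 0)) => ε.comp g) ∧
    ∀ n : ℕ, Function.Exact
      (fun g : C →ₗ[R] (C ⊗[R] ↥(P (n + 2))) => (d (n + 1)).comp g)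
      (fun g : C →ₗ[R] (C ⊗[R] ↥(P (n + 1))) => (d n).comp g) := by
  obtain ⟨⟨F, δ, η, hF, -, hη, -, -⟩, hbij, -⟩ := hC
  obtain ⟨hP, hd, hε, hQ⟩ := hX
  have := hF 0
  have : Module.Finite R C := Module.Finite.of_surjective η hη
  obtain ⟨h1, h2, h3⟩ := hQ R inferInstance
  exact ⟨fun n => projective_hom_tensor R C hbij (P n) (hP n),
    surjective_comp_of_equiv R (TensorProduct.rid R C) ε h1,
    exact_comp_of_equiv R (TensorProduct.rid R C) (d 0) ε hε h2,
    fun n => exact_comp_of_equiv R (TensorProduct.rid R C) (d (n + 1)) (d n) (hd n) (h3 n)⟩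

end
end

section
/- Let R be a commutative ring, C a semidualizing R-module, and M an R-module. The following are equivalent: (i) M admits an exact augmented proper P_C-projective resolution; (ii) every augmented proper P_C-projective resolution of M is exact; (iii) the natural evaluation map ν_M : C ⊗_R Hom_R(C,M) → M is an isomorphism and Tor_i^R(C, Hom_R(C,M)) = 0 for all i ≥ 1. -/
open TensorProduct CategoryTheory

noncomputable section

section Helpers

variable {R : Type} [CommRing R] {C : Type} [AddCommGroup C] [Module R C]

theorem muMap_naturality {P Q : Type} [AddCommGroup P] [Module R P] [AddCommGroup Q] [Module R Q]
    (f : P →ₗ[R] Q) (p : P) :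
    muMap R C Q (f p) = (f.lTensor C).comp (muMap R C P p) := by
  ext c; simp [muMap]

theorem muMap_bijective_finsupp (hfg : Module.Finite R C)
    (hh : Function.Bijective (fun r : R => (r • LinearMap.id : C →ₗ[R] C))) (ι : Type) :
    Function.Bijective (muMap R C (ι →₀ R)) := by
  classical
  set e := TensorProduct.finsuppScalarRight R R C ι with he
  constructor
  · intro p q hpq
    ext i
    apply hh.1
    ext c
    have := congrArg (fun t => e t i) (LinearMap.congr_fun hpq c)
    simpa [muMap, he, TensorProduct.finsuppScalarRight_apply_tmul_apply] using this
  · intro f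
    have hcomp : ∀ i, ∃ r : R, ∀ c, e (f c) i = r • c := by
      intro i
      obtain ⟨r, hr⟩ := hh.2 ((Finsupp.lapply i).comp (e.toLinearMap.comp f))
      refine ⟨r, fun c => ?_⟩
      have := LinearMap.congr_fun hr c
      simpa using this.symm
    choose r hr using hcomp
    obtain ⟨S, hS⟩ := hfg.fg_top
    let T : Finset ι := S.biUnion fun c => (e (f c)).support
    have hT : ∀ i, r i ≠ 0 → i ∈ T := by
      intro i hi
      by_contra hiT
      apply hi
      apply hh.1
      simp only [zero_smul]
      apply LinearMap.ext_on hS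
      intro c hc
      have : e (f c) i = 0 := by
        by_contra h
        exact hiT (Finset.mem_biUnion.2 ⟨c, hc, Finsupp.mem_support_iff.2 h⟩)
      simpa [hr] using this
    refine ⟨Finsupp.onFinset T r hT, ?_⟩
    ext c
    apply e.injective
    ext i
    simp [muMap, he, TensorProduct.finsuppScalarRight_apply_tmul_apply]
    rw [← he, hr]

theorem muMap_bijective (hfg : Module.Finite R C)
    (hh : Function.Bijective (fun r : R => (r • LinearMap.id : C →ₗ[R] C)))
    (P : Type) [AddCommGroup P] [Module R P] (hP : Module.Projective R P) :
    Function.Bijective (muMap R C P) := by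
  obtain ⟨s, hs⟩ := hP.out
  have hb := muMap_bijective_finsupp (C := C) hfg hh P
  have hs' : (Finsupp.linearCombination R id).comp s = LinearMap.id := LinearMap.ext hs
  constructor
  · intro p q hpq
    have : s p = s q := by
      apply hb.1
      rw [muMap_naturality, muMap_naturality, hpq]
    rw [← hs p, ← hs q, this]
  · intro f
    obtain ⟨x, hx⟩ := hb.2 ((s.lTensor C).comp f)
    refine ⟨Finsupp.linearCombination R id x, ?_⟩
    rw [muMap_naturality, hx, ← LinearMap.comp_assoc, ← LinearMap.lTensor_comp, hs',
      LinearMap.lTensor_id, LinearMap.id_comp]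

theorem lTensor_full {Q P : Type} [AddCommGroup Q] [Module R Q] [AddCommGroup P] [Module R P]
    (hmu : Function.Bijective (muMap R C P)) (g : C ⊗[R] Q →ₗ[R] C ⊗[R] P) :
    ∃ f : Q →ₗ[R] P, f.lTensor C = g := by
  let e := LinearEquiv.ofBijective _ hmu
  refine ⟨e.symm.toLinearMap.comp (TensorProduct.curry g).flip, ?_⟩
  apply TensorProduct.ext'
  intro c q
  have h : muMap R C P (e.symm ((TensorProduct.curry g).flip q)) = (TensorProduct.curry g).flip q :=
    e.apply_symm_apply _
  simpa [muMap] using LinearMap.congr_fun h c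

theorem lTensor_faithful {Q P : Type} [AddCommGroup Q] [Module R Q] [AddCommGroup P] [Module R P]
    (hmu : Function.Bijective (muMap R C P)) {f g : Q →ₗ[R] P}
    (h : f.lTensor C = g.lTensor C) : f = g := by
  ext q
  apply hmu.1
  ext c
  simpa [muMap] using LinearMap.congr_fun h (c ⊗ₜ q)

theorem eval_full {Q M : Type} [AddCommGroup Q] [Module R Q] [AddCommGroup M] [Module R M]
    (g : C ⊗[R] Q →ₗ[R] M) :
    ∃ f : Q →ₗ[R] (C →ₗ[R] M), (evalNu R C M).comp (f.lTensor C) = g := by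
  refine ⟨(TensorProduct.curry g).flip, ?_⟩
  apply TensorProduct.ext'
  intro c q
  simp [evalNu]

theorem eval_faithful {Q M : Type} [AddCommGroup Q] [Module R Q] [AddCommGroup M] [Module R M]
    {f g : Q →ₗ[R] (C →ₗ[R] M)}
    (h : (evalNu R C M).comp (f.lTensor C) = (evalNu R C M).comp (g.lTensor C)) : f = g := by
  ext q c
  simpa [evalNu] using LinearMap.congr_fun h (c ⊗ₜ q)

theorem exact_lift {Q A B D : Type} [AddCommGroup Q] [Module R Q] [AddCommGroup A] [Module R A]
    [AddCommGroup B] [Module R B] [AddCommGroup D] [Module R D] (hQ : Module.Projective R Q)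
    (f : A →ₗ[R] B) (g : B →ₗ[R] D) (hfg : Function.Exact f g) (u : Q →ₗ[R] B)
    (hu : g.comp u = 0) : ∃ v : Q →ₗ[R] A, f.comp v = u := by
  have hr : ∀ q, u q ∈ LinearMap.range f := fun q => (hfg (u q)).1 (LinearMap.congr_fun hu q)
  obtain ⟨v, hv⟩ := Module.projective_lifting_property f.rangeRestrict
    (u.codRestrict (LinearMap.range f) hr) f.surjective_rangeRestrict
  refine ⟨v, ?_⟩
  ext q
  exact congrArg Subtype.val (LinearMap.congr_fun hv q)

/-- A projective resolution of modules, unbundled. -/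
def IsProjRes (N : Type) [AddCommGroup N] [Module R N] (P : ℕ → ModuleCat.{0} R)
    (D : ∀ n : ℕ, ↥(P (n + 1)) →ₗ[R] ↥(P n)) (η : ↥(P 0) →ₗ[R] N) : Prop :=
  (∀ n, Module.Projective R ↥(P n)) ∧ Function.Surjective η ∧ Function.Exact (D 0) η ∧
    ∀ n, Function.Exact (D (n + 1)) (D n)

theorem exists_projRes (N : Type) [AddCommGroup N] [Module R N] :
    ∃ (P : ℕ → ModuleCat.{0} R) (D : ∀ n : ℕ, ↥(P (n + 1)) →ₗ[R] ↥(P n)) (η : ↥(P 0) →ₗ[R] N),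
      IsProjRes N P D η := by
  let K := projectiveResolution (ModuleCat.of R N)
  refine ⟨K.complex.X, fun n => (K.complex.d (n + 1) n).hom, (K.π.f 0).hom, ?_, ?_, ?_, ?_⟩
  · intro n
    exact (IsProjective.iff_projective _).2 (K.projective n)
  · exact (ModuleCat.epi_iff_surjective (K.π.f 0)).1 inferInstance
  · exact (ShortComplex.ShortExact.moduleCat_exact_iff_function_exact _).1 K.exact₀
  · intro n
    exact (ShortComplex.ShortExact.moduleCat_exact_iff_function_exact _).1 (K.exact_succ n)

theorem projRes_complex {N : Type} [AddCommGroup N] [Module R N] {P : ℕ → ModuleCat.{0} R}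
    {D : ∀ n : ℕ, ↥(P (n + 1)) →ₗ[R] ↥(P n)} {η : ↥(P 0) →ₗ[R] N} (h : IsProjRes N P D η) (n : ℕ) :
    ModuleCat.ofHom (D (n + 1)) ≫ ModuleCat.ofHom (D n) = 0 := by
  ext x
  exact (h.2.2.2 n).apply_apply_eq_zero x

/-- The chain complex of an unbundled resolution. -/
def projResComplex {N : Type} [AddCommGroup N] [Module R N] {P : ℕ → ModuleCat.{0} R}
    {D : ∀ n : ℕ, ↥(P (n + 1)) →ₗ[R] ↥(P n)} {η : ↥(P 0) →ₗ[R] N} (h : IsProjRes N P D η) :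
    ChainComplex (ModuleCat.{0} R) ℕ :=
  ChainComplex.of P (fun n => ModuleCat.ofHom (D n)) (projRes_complex h)

theorem projResComplex_d {N : Type} [AddCommGroup N] [Module R N] {P : ℕ → ModuleCat.{0} R}
    {D : ∀ n : ℕ, ↥(P (n + 1)) →ₗ[R] ↥(P n)} {η : ↥(P 0) →ₗ[R] N} (h : IsProjRes N P D η) (n : ℕ) :
    (projResComplex h).d (n + 1) n = ModuleCat.ofHom (D n) :=
  ChainComplex.of_d P (fun n => ModuleCat.ofHom (D n)) n

theorem projResComplex_exactAt {N : Type} [AddCommGroup N] [Module R N] {P : ℕ → ModuleCat.{0} R}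
    {D : ∀ n : ℕ, ↥(P (n + 1)) →ₗ[R] ↥(P n)} {η : ↥(P 0) →ₗ[R] N} (h : IsProjRes N P D η) (n : ℕ) :
    (projResComplex h).ExactAt (n + 1) := by
  rw [HomologicalComplex.exactAt_iff' _ (n + 1 + 1) (n + 1) n (by simp) (by simp)]
  rw [ShortComplex.ShortExact.moduleCat_exact_iff_function_exact]
  change Function.Exact ((projResComplex h).d (n + 1 + 1) (n + 1)) ((projResComplex h).d (n + 1) n)
  rw [projResComplex_d, projResComplex_d]
  exact h.2.2.2 n

theorem projRes_aug {N : Type} [AddCommGroup N] [Module R N] {P : ℕ → ModuleCat.{0} R}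
    {D : ∀ n : ℕ, ↥(P (n + 1)) →ₗ[R] ↥(P n)} {η : ↥(P 0) →ₗ[R] N} (h : IsProjRes N P D η) :
    (projResComplex h).d 1 0 ≫ (ModuleCat.ofHom η : (projResComplex h).X 0 ⟶ ModuleCat.of R N)
      = 0 := by
  rw [projResComplex_d]
  ext x
  exact h.2.2.1.apply_apply_eq_zero x

/-- The bundled projective resolution. -/
def projResBundled {N : Type} [AddCommGroup N] [Module R N] {P : ℕ → ModuleCat.{0} R}
    {D : ∀ n : ℕ, ↥(P (n + 1)) →ₗ[R] ↥(P n)} {η : ↥(P 0) →ₗ[R] N} (h : IsProjRes N P D η) :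
    ProjectiveResolution (ModuleCat.of R N) where
  complex := projResComplex h
  projective n := (IsProjective.iff_projective _).1 (h.1 n)
  π := (ChainComplex.toSingle₀Equiv _ _).symm ⟨ModuleCat.ofHom η, projRes_aug h⟩
  quasiIso := ⟨fun n => by
    cases n
    · rw [ChainComplex.quasiIsoAt₀_iff, ShortComplex.quasiIso_iff_of_zeros']
      · refine (ShortComplex.exact_and_epi_g_iff_of_iso
          (S₂ := ShortComplex.mk ((projResComplex h).d 1 0) (ModuleCat.ofHom η)
            (projRes_aug h)) ?_).2 ⟨?_, ?_⟩
        · exact ShortComplex.isoMk (Iso.refl _) (Iso.refl _) (Iso.refl _)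
            ((Category.id_comp _).trans (Category.comp_id _).symm)
            (by
              have e := ChainComplex.toSingle₀Equiv_symm_apply_f_zero (C := projResComplex h)
                (X := ModuleCat.of R N) (ModuleCat.ofHom η) (projRes_aug h)
              refine (Category.id_comp _).trans ?_
              refine Eq.trans ?_ (Category.comp_id _).symm
              exact e.symm)
        · rw [ShortComplex.ShortExact.moduleCat_exact_iff_function_exact]
          change Function.Exact ((projResComplex h).d 1 0) (ModuleCat.ofHom η)
          rw [projResComplex_d]
          exact h.2.2.1
        · exact (ModuleCat.epi_iff_surjective _).2 h.2.1
      all_goals rfl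
    · rw [quasiIsoAt_iff_exactAt']
      · apply projResComplex_exactAt
      · apply ChainComplex.exactAt_succ_single_obj⟩

theorem tor_iff {N : Type} [AddCommGroup N] [Module R N] {P : ℕ → ModuleCat.{0} R}
    {D : ∀ n : ℕ, ↥(P (n + 1)) →ₗ[R] ↥(P n)} {η : ↥(P 0) →ₗ[R] N} (h : IsProjRes N P D η) (n : ℕ) :
    Subsingleton (torMod R C N (n + 1)) ↔
      Function.Exact ((D (n + 1)).lTensor C) ((D n).lTensor C) := by
  let F := (MonoidalCategory.tensoringLeft (ModuleCat.{0} R)).obj (ModuleCat.of R C)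
  let X := (F.mapHomologicalComplex _).obj (projResComplex h)
  have i1 : torMod R C N (n + 1) ≅ X.homology (n + 1) :=
    (projResBundled h).isoLeftDerivedObj F (n + 1)
  rw [← ModuleCat.isZero_iff_subsingleton, i1.isZero_iff,
    ← HomologicalComplex.exactAt_iff_isZero_homology,
    HomologicalComplex.exactAt_iff' _ (n + 1 + 1) (n + 1) n (by simp) (by simp),
    ShortComplex.ShortExact.moduleCat_exact_iff_function_exact]
  change Function.Exact (F.map ((projResComplex h).d (n + 1 + 1) (n + 1)))
    (F.map ((projResComplex h).d (n + 1) n)) ↔ _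
  rw [projResComplex_d, projResComplex_d]
  exact Iff.rfl

theorem resExact_iff {M : Type} [AddCommGroup M] [Module R M] {P : ℕ → ModuleCat.{0} R}
    {D : ∀ n : ℕ, ↥(P (n + 1)) →ₗ[R] ↥(P n)} {η : ↥(P 0) →ₗ[R] (C →ₗ[R] M)}
    (h : IsProjRes (C →ₗ[R] M) P D η) :
    ResExact R C M P (fun n => (D n).lTensor C) ((evalNu R C M).comp (η.lTensor C)) ↔
      (Function.Bijective (evalNu R C M) ∧
        ∀ i : ℕ, 1 ≤ i → Subsingleton (torMod R C (C →ₗ[R] M) i)) := by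
  have hsurj : Function.Surjective (η.lTensor C) := LinearMap.lTensor_surjective C h.2.1
  have hex : Function.Exact ((D 0).lTensor C) (η.lTensor C) := lTensor_exact C h.2.2.1 h.2.1
  constructor
  · rintro ⟨h1, h2, h3⟩
    refine ⟨⟨?_, ?_⟩, ?_⟩
    · rw [injective_iff_map_eq_zero]
      intro y hy
      obtain ⟨x, rfl⟩ := hsurj y
      exact (hex x).2 ((h2 x).1 hy)
    · intro m
      obtain ⟨x, hx⟩ := h1 m
      exact ⟨_, hx⟩
    · intro i hi
      obtain ⟨n, rfl⟩ : ∃ n, i = n + 1 := ⟨i - 1, by omega⟩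
      exact (tor_iff h n).2 (h3 n)
  · rintro ⟨hb, ht⟩
    refine ⟨hb.2.comp hsurj, ?_, fun n => (tor_iff h n).1 (ht (n + 1) (by omega))⟩
    intro x
    rw [← hex x]
    exact map_eq_zero_iff _ hb.1

theorem isAugProperRes_of_projRes
    (hmu : ∀ (P : Type) [AddCommGroup P] [Module R P], Module.Projective R P →
      Function.Bijective (muMap R C P))
    {M : Type} [AddCommGroup M] [Module R M] {P : ℕ → ModuleCat.{0} R}
    {D : ∀ n : ℕ, ↥(P (n + 1)) →ₗ[R] ↥(P n)} {η : ↥(P 0) →ₗ[R] (C →ₗ[R] M)}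
    (h : IsProjRes (C →ₗ[R] M) P D η) :
    IsAugProperRes R C M P (fun n => (D n).lTensor C) ((evalNu R C M).comp (η.lTensor C)) := by
  have hD : ∀ n, (D n).comp (D (n + 1)) = 0 := fun n => (h.2.2.2 n).linearMap_comp_eq_zero
  have hη : η.comp (D 0) = 0 := h.2.2.1.linearMap_comp_eq_zero
  have c1 : ∀ n, ((D n).lTensor C).comp ((D (n + 1)).lTensor C) = 0 := fun n => by
    rw [← LinearMap.lTensor_comp, hD, LinearMap.lTensor_zero]
  have c2 : ((evalNu R C M).comp (η.lTensor C)).comp ((D 0).lTensor C) = 0 := by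
    rw [LinearMap.comp_assoc, ← LinearMap.lTensor_comp, hη, LinearMap.lTensor_zero,
      LinearMap.comp_zero]
  refine ⟨h.1, c1, c2, ?_⟩
  intro Q _ _ hQ
  refine ⟨?_, ?_, ?_⟩
  · intro g
    obtain ⟨f, rfl⟩ := eval_full g
    obtain ⟨v, rfl⟩ := Module.projective_lifting_property η f h.2.1
    exact ⟨v.lTensor C, by simp only [LinearMap.lTensor_comp, LinearMap.comp_assoc]⟩
  · intro g
    constructor
    · intro hg
      obtain ⟨f, rfl⟩ := lTensor_full (hmu _ (h.1 0)) g
      have : η.comp f = 0 := by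
        apply eval_faithful (C := C)
        rw [LinearMap.lTensor_comp, LinearMap.lTensor_zero, LinearMap.comp_zero,
          ← LinearMap.comp_assoc]
        exact hg
      obtain ⟨v, rfl⟩ := exact_lift hQ _ _ h.2.2.1 f this
      exact ⟨v.lTensor C, by simp only [LinearMap.lTensor_comp]⟩
    · rintro ⟨k, rfl⟩
      change LinearMap.comp _ (LinearMap.comp _ k) = 0
      rw [← LinearMap.comp_assoc, c2, LinearMap.zero_comp]
  · intro n g
    constructor
    · intro hg
      obtain ⟨f, rfl⟩ := lTensor_full (hmu _ (h.1 (n + 1))) g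
      have : (D n).comp f = 0 := by
        apply lTensor_faithful (hmu _ (h.1 n))
        rw [LinearMap.lTensor_comp, LinearMap.lTensor_zero]
        exact hg
      obtain ⟨v, rfl⟩ := exact_lift hQ _ _ (h.2.2.2 n) f this
      exact ⟨v.lTensor C, by simp only [LinearMap.lTensor_comp]⟩
    · rintro ⟨k, rfl⟩
      change LinearMap.comp _ (LinearMap.comp _ k) = 0
      rw [← LinearMap.comp_assoc, c1, LinearMap.zero_comp]

theorem projRes_of_isAugProperRes
    (hmu : ∀ (P : Type) [AddCommGroup P] [Module R P], Module.Projective R P →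
      Function.Bijective (muMap R C P))
    {M : Type} [AddCommGroup M] [Module R M] {P : ℕ → ModuleCat.{0} R}
    {d : ∀ n : ℕ, (C ⊗[R] ↥(P (n + 1))) →ₗ[R] (C ⊗[R] ↥(P n))}
    {ε : (C ⊗[R] ↥(P 0)) →ₗ[R] M} (h : IsAugProperRes R C M P d ε) :
    ∃ (D : ∀ n : ℕ, ↥(P (n + 1)) →ₗ[R] ↥(P n)) (η : ↥(P 0) →ₗ[R] (C →ₗ[R] M)),
      IsProjRes (C →ₗ[R] M) P D η ∧ d = (fun n => (D n).lTensor C) ∧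
        ε = (evalNu R C M).comp (η.lTensor C) := by
  obtain ⟨hP, c1, c2, hex⟩ := h
  choose D hD using fun n => lTensor_full (hmu _ (hP n)) (d n)
  obtain ⟨η, rfl⟩ := eval_full ε
  obtain rfl : d = (fun n => (D n).lTensor C) := funext fun n => (hD n).symm
  obtain ⟨e1, e2, e3⟩ := hex R inferInstance
  refine ⟨D, η, ⟨hP, ?_, ?_, ?_⟩, rfl, rfl⟩
  · intro f
    obtain ⟨g, hg⟩ := e1 ((evalNu R C M).comp ((LinearMap.toSpanSingleton R _ f).lTensor C))
    obtain ⟨g, rfl⟩ := lTensor_full (hmu _ (hP 0)) g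
    have : η.comp g = LinearMap.toSpanSingleton R _ f := by
      apply eval_faithful
      rw [LinearMap.lTensor_comp, ← LinearMap.comp_assoc]
      exact hg
    exact ⟨g 1, by simpa using LinearMap.congr_fun this 1⟩
  · intro x
    constructor
    · intro hx
      have h0 : η.comp (LinearMap.toSpanSingleton R _ x) = 0 := by
        ext; simp [hx]
      obtain ⟨g, hg⟩ := (e2 ((LinearMap.toSpanSingleton R _ x).lTensor C)).1 (by
        change LinearMap.comp (LinearMap.comp _ _) _ = 0
        rw [LinearMap.comp_assoc, ← LinearMap.lTensor_comp, h0, LinearMap.lTensor_zero,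
          LinearMap.comp_zero])
      obtain ⟨g, rfl⟩ := lTensor_full (hmu _ (hP 1)) g
      have : (D 0).comp g = LinearMap.toSpanSingleton R _ x := by
        apply lTensor_faithful (hmu _ (hP 0))
        rw [LinearMap.lTensor_comp]
        exact hg
      exact ⟨g 1, by simpa using LinearMap.congr_fun this 1⟩
    · rintro ⟨y, rfl⟩
      have : η.comp (D 0) = 0 := by
        apply eval_faithful (C := C)
        rw [LinearMap.lTensor_comp, LinearMap.lTensor_zero, LinearMap.comp_zero,
          ← LinearMap.comp_assoc]
        exact c2
      exact LinearMap.congr_fun this y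
  · intro n x
    constructor
    · intro hx
      have h0 : (D n).comp (LinearMap.toSpanSingleton R _ x) = 0 := by
        ext; simp [hx]
      obtain ⟨g, hg⟩ := (e3 n ((LinearMap.toSpanSingleton R _ x).lTensor C)).1 (by
        change LinearMap.comp _ _ = 0
        rw [← LinearMap.lTensor_comp, h0, LinearMap.lTensor_zero])
      obtain ⟨g, rfl⟩ := lTensor_full (hmu _ (hP (n + 2))) g
      have : (D (n + 1)).comp g = LinearMap.toSpanSingleton R _ x := by
        apply lTensor_faithful (hmu _ (hP (n + 1)))
        rw [LinearMap.lTensor_comp]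
        exact hg
      exact ⟨g 1, by simpa using LinearMap.congr_fun this 1⟩
    · rintro ⟨y, rfl⟩
      have : (D n).comp (D (n + 1)) = 0 := by
        apply lTensor_faithful (hmu _ (hP n))
        rw [LinearMap.lTensor_comp, LinearMap.lTensor_zero]
        exact c1 n
      exact LinearMap.congr_fun this y

end Helpers

/-- `M` admits an exact augmented proper `P_C`-projective resolution iff all such
resolutions are exact, iff `ν_M` is an isomorphism and `Tor_i^R(C, Hom_R(C,M)) = 0`
for all `i ≥ 1`. -/
theorem augProperRes_exact_iff
    (R : Type) [CommRing R] (C : Type) [AddCommGroup C] [Module R C]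
    (M : Type) [AddCommGroup M] [Module R M] (hC : IsSemidualizing R C) :
    ((∃ (P : ℕ → ModuleCat.{0} R)
        (d : ∀ k : ℕ, (C ⊗[R] ↥(P (k + 1))) →ₗ[R] (C ⊗[R] ↥(P k)))
        (ε : (C ⊗[R] ↥(P 0)) →ₗ[R] M),
          IsAugProperRes R C M P d ε ∧ ResExact R C M P d ε) ↔
      (Function.Bijective (evalNu R C M) ∧
        ∀ i : ℕ, 1 ≤ i → Subsingleton (torMod R C (C →ₗ[R] M) i))) ∧
    ((∀ (P : ℕ → ModuleCat.{0} R)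
        (d : ∀ k : ℕ, (C ⊗[R] ↥(P (k + 1))) →ₗ[R] (C ⊗[R] ↥(P k)))
        (ε : (C ⊗[R] ↥(P 0)) →ₗ[R] M),
          IsAugProperRes R C M P d ε → ResExact R C M P d ε) ↔
      (Function.Bijective (evalNu R C M) ∧
        ∀ i : ℕ, 1 ≤ i → Subsingleton (torMod R C (C →ₗ[R] M) i))) := by
  have hfg : Module.Finite R C := by
    obtain ⟨⟨P, d, ε, hf, -, hs, -⟩, -⟩ := hC
    have := hf 0
    exact Module.Finite.of_surjective ε hs
  have hmu : ∀ (P : Type) [AddCommGroup P] [Module R P], Module.Projective R P →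
      Function.Bijective (muMap R C P) := fun P _ _ hP => muMap_bijective hfg hC.2.1 P hP
  have key : ∀ (P : ℕ → ModuleCat.{0} R)
        (d : ∀ k : ℕ, (C ⊗[R] ↥(P (k + 1))) →ₗ[R] (C ⊗[R] ↥(P k)))
        (ε : (C ⊗[R] ↥(P 0)) →ₗ[R] M), IsAugProperRes R C M P d ε →
        (ResExact R C M P d ε ↔ (Function.Bijective (evalNu R C M) ∧
        ∀ i : ℕ, 1 ≤ i → Subsingleton (torMod R C (C →ₗ[R] M) i))) := by
    intro P d ε h
    obtain ⟨D, η, hr, rfl, rfl⟩ := projRes_of_isAugProperRes hmu h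
    exact resExact_iff hr
  obtain ⟨P, D, η, hr⟩ := exists_projRes (R := R) (C →ₗ[R] M)
  have hp := isAugProperRes_of_projRes hmu hr
  refine ⟨⟨?_, fun h => ⟨_, _, _, hp, (key _ _ _ hp).2 h⟩⟩,
    ⟨fun h => (key _ _ _ hp).1 (h _ _ _ hp), fun h P d ε hp' => (key _ _ _ hp').2 h⟩⟩
  rintro ⟨P, d, ε, h1, h2⟩
  exact (key _ _ _ h1).1 h2

end
end

section
/- Let R be a commutative ring, C an R-module, and M an R-module such that the natural evaluation map ν_M : C ⊗_R Hom_R(C,M) → M is injective. Then the composition μ_{Hom_R(C,M)} ∘ Hom_R(C, ν_M) is the identity map on Hom_R(C, C ⊗_R Hom_R(C,M)); consequently Hom_R(C, ν_M) : Hom_R(C, C ⊗_R Hom_R(C,M)) → Hom_R(C,M) is an isomorphism with inverse μ_{Hom_R(C,M)}. -/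
open TensorProduct CategoryTheory

noncomputable section

/-- If `ν_M` is injective, then `μ_{Hom(C,M)} ∘ Hom(C,ν_M)` is the identity on
`Hom_R(C, C ⊗_R Hom_R(C,M))`; hence `Hom(C,ν_M)` is an isomorphism with inverse
`μ_{Hom(C,M)}`. -/
theorem mu_comp_homNu_eq_id_of_injective
    (R : Type) [CommRing R] (C : Type) [AddCommGroup C] [Module R C]
    (M : Type) [AddCommGroup M] [Module R M]
    (hν : Function.Injective (evalNu R C M)) :
    (∀ g : C →ₗ[R] (C ⊗[R] (C →ₗ[R] M)),
        (muMap R C (C →ₗ[R] M)) ((evalNu R C M).comp g) = g) ∧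
    Function.Bijective
      (fun g : C →ₗ[R] (C ⊗[R] (C →ₗ[R] M)) => (evalNu R C M).comp g) ∧
    (∀ f : C →ₗ[R] M, (evalNu R C M).comp ((muMap R C (C →ₗ[R] M)) f) = f) := by
  have h3 : ∀ f : C →ₗ[R] M, (evalNu R C M).comp ((muMap R C (C →ₗ[R] M)) f) = f := by
    intro f
    ext c
    simp [evalNu, muMap]
  have h1 : ∀ g : C →ₗ[R] (C ⊗[R] (C →ₗ[R] M)),
      (muMap R C (C →ₗ[R] M)) ((evalNu R C M).comp g) = g := by
    intro g
    apply LinearMap.ext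
    intro c
    apply hν
    exact LinearMap.congr_fun (h3 ((evalNu R C M).comp g)) c
  exact ⟨h1, Function.bijective_iff_has_inverse.mpr
    ⟨fun f => muMap R C (C →ₗ[R] M) f, h1, h3⟩, h3⟩

end
end

section
/- Let R be a commutative ring, C a semidualizing R-module, and M an R-module. Assume Ext_R^1(C, C ⊗_R Hom_R(C,M)) = 0. If the natural evaluation map ν_M : C ⊗_R Hom_R(C,M) → M is injective, then it is an isomorphism. -/
open TensorProduct CategoryTheory

noncomputable section

/-- A finitely generated faithful module has nonzero maps to every nonzero module
(McCoy-style argument with minors of the relations). -/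
theorem aux_exists_hom_ne_zero (R : Type) [CommRing R] (C : Type) [AddCommGroup C] [Module R C]
    (N : Type) [AddCommGroup N] [Module R N] [Module.Finite R C]
    (hf : ∀ r : R, (∀ c : C, r • c = 0) → r = 0) (x : N) (hx : x ≠ 0) :
    ∃ φ : C →ₗ[R] N, φ ≠ 0 := by
  obtain ⟨n, p, hp⟩ := Module.Finite.exists_fin' R C
  let Q : ℕ → Prop := fun r => ∃ (v : Fin r → (Fin n → R)) (s : Fin r → Fin n),
    (∀ i, p (v i) = 0) ∧ (Matrix.of fun i j => v i (s j)).det • x ≠ 0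
  have h0 : Q 0 := ⟨Fin.elim0, Fin.elim0, fun i => i.elim0, by simpa using hx⟩
  have hn : ¬ Q n := by
    rintro ⟨v, s, hv, hd⟩
    apply hd
    have hz : (Matrix.of fun i j => v i (s j)).det = 0 := by
      by_cases hs : Function.Injective s
      · have hb : Function.Bijective s := Finite.injective_iff_bijective.mp hs
        let e : Fin n ≃ Fin n := Equiv.ofBijective s hb
        have h1 : (Matrix.of v).det = 0 := by
          apply hf
          have key : ∀ w : Fin n → R, (Matrix.of v).det • p w = 0 := by
            intro w
            have : (Matrix.of v).det • w = Matrix.vecMul (Matrix.vecMul w (Matrix.of v).adjugate) (Matrix.of v) := by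
              rw [Matrix.vecMul_vecMul, Matrix.adjugate_mul, Matrix.vecMul_smul, Matrix.vecMul_one]
            rw [← map_smul, this]
            have h2 : ∀ u : Fin n → R, Matrix.vecMul u (Matrix.of v) = ∑ i, u i • v i := by
              intro u
              ext j
              simp [Matrix.vecMul, dotProduct]
            rw [h2, map_sum]
            exact Finset.sum_eq_zero fun i _ => by rw [map_smul, hv, smul_zero]
          intro c
          obtain ⟨w, rfl⟩ := hp c
          exact key w
        have h3 : (Matrix.of fun i j => v i (s j)) = (Matrix.of v).submatrix id e := rfl
        rw [h3, Matrix.det_permute', h1, mul_zero]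
      · simp only [Function.Injective, not_forall] at hs
        obtain ⟨i, j, hij, hne⟩ := hs
        exact Matrix.det_zero_of_column_eq hne (fun k => by simp [hij])
    rw [hz, zero_smul]
  have hlt : ∃ r, r < n ∧ Q r ∧ ¬ Q (r + 1) := by
    by_contra hcon
    push Not at hcon
    have : ∀ r, r ≤ n → Q r := by
      intro r
      induction r with
      | zero => intro _; exact h0
      | succ k ih => intro hk; exact hcon k (by omega) (ih (by omega))
    exact hn (this n le_rfl)
  obtain ⟨r, hr, ⟨v, s, hv, hd⟩, hmax⟩ := hlt
  obtain ⟨t, ht⟩ : ∃ t, ∀ j, s j ≠ t := by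
    by_contra hcon
    push Not at hcon
    have := Fintype.card_le_of_surjective s hcon
    simp at this
    omega
  let s' : Fin (r + 1) → Fin n := Fin.cons t s
  let row : (Fin n → R) → Matrix (Fin (r+1)) (Fin (r+1)) R := fun w =>
    Matrix.of fun i j => (Fin.cons w v : Fin (r+1) → Fin n → R) i (s' j)
  let base : Matrix (Fin (r+1)) (Fin (r+1)) R := row 0
  have hrow : ∀ w, row w = base.updateRow 0 (fun j => w (s' j)) := by
    intro w
    ext i j
    refine Fin.cases ?_ (fun i => ?_) i
    · simp [row]
    · simp [row, base, Matrix.updateRow_ne]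
  let φ : (Fin n → R) →ₗ[R] N :=
    { toFun := fun w => (row w).det • x
      map_add' := fun a b => by
        rw [hrow, hrow a, hrow b, ← add_smul, ← Matrix.det_updateRow_add]
        rfl
      map_smul' := fun c a => by
        rw [hrow, hrow a, RingHom.id_apply, smul_smul, ← Matrix.det_updateRow_smul]
        rfl }
  have hker : LinearMap.ker p ≤ LinearMap.ker φ := by
    intro w hw
    rw [LinearMap.mem_ker] at hw ⊢
    by_contra hne
    apply hmax
    refine ⟨Fin.cons w v, s', ?_, hne⟩
    intro i
    refine Fin.cases ?_ (fun i => ?_) i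
    · simpa using hw
    · simpa using hv i
  have hφ : φ (Pi.single t 1) = (Matrix.of fun i j => v i (s j)).det • x := by
    change (row (Pi.single t 1)).det • x = _
    congr 1
    rw [Matrix.det_succ_row_zero, Fin.sum_univ_succ, Finset.sum_eq_zero]
    · simp [row, s', Matrix.submatrix]
    · intro j _
      simp [row, s', ht]
  refine ⟨(LinearMap.ker p).liftQ φ hker ∘ₗ (p.quotKerEquivOfSurjective hp).symm.toLinearMap, ?_⟩
  intro h
  apply hd
  rw [← hφ]
  have h4 := LinearMap.congr_fun h (p (Pi.single t 1))
  have h5 : (p.quotKerEquivOfSurjective hp).symm (p (Pi.single t 1))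
      = Submodule.Quotient.mk (Pi.single t 1) := by
    rw [LinearEquiv.symm_apply_eq]; rfl
  simpa [h5] using h4

/-- Vanishing of `Ext¹(C,X)` gives lifting along surjections with kernel `X`. -/
theorem aux_lift (R : Type) [CommRing R] (C X M N : ModuleCat.{0} R) (f : X ⟶ M) (g : M ⟶ N)
    [Mono f] [Epi g] (w : f ≫ g = 0) (hfg : (ShortComplex.mk f g w).Exact)
    (hext : Subsingleton (((Ext R (ModuleCat.{0} R) 1).obj (Opposite.op C)).obj X))
    (h : C ⟶ N) : ∃ k : C ⟶ M, k ≫ g = h := by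
  let P : ProjectiveResolution C := ProjectiveResolution.of C
  have hz := ModuleCat.isZero_of_subsingleton
    (((Ext R (ModuleCat.{0} R) 1).obj (Opposite.op C)).obj X)
  have hz2 := hz.of_iso (P.isoExt (R := R) 1 X).symm
  rw [← HomologicalComplex.exactAt_iff_isZero_homology,
    HomologicalComplex.exactAt_iff' _ 0 1 2 (by simp) (by simp),
    ShortComplex.moduleCat_exact_iff] at hz2
  have hdesc : ∃ (π : P.complex.X 0 ⟶ C), Epi π ∧ P.complex.d 1 0 ≫ π = 0 ∧
      ∀ (Z : ModuleCat.{0} R) (u : P.complex.X 0 ⟶ Z), P.complex.d 1 0 ≫ u = 0 →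
        ∃ k : C ⟶ Z, π ≫ k = u :=
    ⟨P.π.f 0, (inferInstance : Epi (P.π.f 0)), P.complex_d_comp_π_f_zero, fun Z u hu =>
      ⟨P.isColimitCokernelCofork.desc (Limits.CokernelCofork.ofπ u hu),
        P.isColimitCokernelCofork.fac (Limits.CokernelCofork.ofπ u hu) .one⟩⟩
  have hex : ∀ b : P.complex.X 1 ⟶ X, P.complex.d 2 1 ≫ b = 0 →
      ∃ l : P.complex.X 0 ⟶ X, P.complex.d 1 0 ≫ l = b := fun b hb => hz2 b hb
  obtain ⟨π, he, hπ, hdesc⟩ := hdesc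
  let a : P.complex.X 0 ⟶ M := Projective.factorThru (π ≫ h) g
  have ha : a ≫ g = π ≫ h := Projective.factorThru_comp _ _
  have hb0 : (P.complex.d 1 0 ≫ a) ≫ g = 0 := by
    rw [Category.assoc, ha, ← Category.assoc, hπ, Limits.zero_comp]
  let b : P.complex.X 1 ⟶ X := hfg.lift _ hb0
  have hb : b ≫ f = P.complex.d 1 0 ≫ a := hfg.lift_f _ hb0
  have hb2 : P.complex.d 2 1 ≫ b = 0 := by
    rw [← cancel_mono f, Category.assoc, hb, ← Category.assoc, P.complex.d_comp_d]
    simp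
  obtain ⟨l, hl⟩ := hex b hb2
  obtain ⟨k, hk⟩ := hdesc M (a - l ≫ f) (by
    rw [Preadditive.comp_sub, ← Category.assoc, hl, hb, sub_self])
  refine ⟨k, ?_⟩
  rw [← cancel_epi π, ← Category.assoc, hk, Preadditive.sub_comp, Category.assoc, w, ha]
  simp

/-- If `Ext¹_R(C, C ⊗_R Hom_R(C,M)) = 0` and the evaluation map `ν_M` is injective,
then `ν_M` is an isomorphism. -/
theorem nu_bijective_of_injective
    (R : Type) [CommRing R] (C : Type) [AddCommGroup C] [Module R C]
    (M : Type) [AddCommGroup M] [Module R M] (hC : IsSemidualizing R C)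
    (hext : Subsingleton (extMod R C (C ⊗[R] (C →ₗ[R] M)) 1))
    (hinj : Function.Injective (evalNu R C M)) :
    Function.Bijective (evalNu R C M) := by
  refine ⟨hinj, ?_⟩
  obtain ⟨⟨P, d, ε, hfin, -, hε, -, -⟩, hhom, -⟩ := hC
  have := hfin 0
  have : Module.Finite R C := Module.Finite.of_surjective ε hε
  have hf : ∀ r : R, (∀ c : C, r • c = 0) → r = 0 := by
    intro r hr
    apply hhom.1
    ext c
    simp [hr]
  rw [← LinearMap.range_eq_top]
  by_contra hne
  obtain ⟨m, hm⟩ : ∃ m, m ∉ LinearMap.range (evalNu R C M) := by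
    by_contra hcon
    push Not at hcon
    exact hne (eq_top_iff.2 fun m _ => hcon m)
  let q := (LinearMap.range (evalNu R C M)).mkQ
  obtain ⟨φ, hφ⟩ := aux_exists_hom_ne_zero R C (M ⧸ LinearMap.range (evalNu R C M)) hf (q m)
    (by simpa [q] using hm)
  apply hφ
  have w : ModuleCat.ofHom (evalNu R C M) ≫ ModuleCat.ofHom q = 0 := by
    ext1
    exact LinearMap.range_mkQ_comp _
  have : Mono (ModuleCat.ofHom (evalNu R C M)) := (ModuleCat.mono_iff_injective _).2 hinj
  have : Epi (ModuleCat.ofHom q) := (ModuleCat.epi_iff_surjective _).2 (Submodule.mkQ_surjective _)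
  obtain ⟨k, hk⟩ := aux_lift R (ModuleCat.of R C) _ _ _ (ModuleCat.ofHom (evalNu R C M))
    (ModuleCat.ofHom q) w (by
      rw [ShortComplex.moduleCat_exact_iff_range_eq_ker]
      exact (Submodule.ker_mkQ _).symm) hext (ModuleCat.ofHom φ)
  ext c
  have h1 : q (k.hom c) = φ c := congrArg (fun z => z.hom c) hk
  rw [← h1, LinearMap.zero_apply]
  refine (Submodule.Quotient.mk_eq_zero _).2 ⟨c ⊗ₜ k.hom, ?_⟩
  simp [evalNu]

end
end

section
/- Let R be a commutative ring, C a semidualizing R-module, and M an R-module. Then M belongs to the Bass class B_C if and only if Hom_R(C,M) belongs to the Auslander class A_C. -/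
open TensorProduct CategoryTheory

noncomputable section

/-- McCoy: a linear system whose maximal minors vanish has a nonzero solution with
coefficients in any nonzero module. -/
lemma mccoy_aux {R N ι : Type} [CommRing R] [AddCommGroup N] [Module R N] {n : ℕ}
    (B : Matrix ι (Fin n) R) (hB : ∀ f : Fin n → ι, (B.submatrix f id).det = 0)
    (x : N) (hx : x ≠ 0) :
    ∃ v : Fin n → N, v ≠ 0 ∧ ∀ i, ∑ j, B i j • v j = 0 := by
  classical
  have hn : ∀ (f : Fin n → ι) (g : Fin n → Fin n), (B.submatrix f g).det • x = 0 := by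
    intro f g
    have : (B.submatrix f g).det = 0 := by
      by_cases hg : Function.Injective g
      · let σ : Equiv.Perm (Fin n) := Equiv.ofBijective g (Finite.injective_iff_bijective.1 hg)
        have h := Matrix.det_permute' σ (B.submatrix f id)
        rw [hB f, mul_zero] at h
        exact h
      · simp only [Function.Injective, not_forall] at hg
        obtain ⟨a, b, hab, hne⟩ := hg
        exact Matrix.det_zero_of_column_eq hne (fun i => by simp [hab])
    rw [this, zero_smul]
  have hex : ∃ k : ℕ, ∀ (f : Fin k → ι) (g : Fin k → Fin n),
      (B.submatrix f g).det • x = 0 := ⟨n, hn⟩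
  have hkn : Nat.find hex ≤ n := Nat.find_min' hex hn
  have hspec := Nat.find_spec hex
  have hmin := fun m => Nat.find_min (m := m) hex
  generalize Nat.find hex = k at hkn hspec hmin
  cases k with
  | zero =>
    exfalso
    have := hspec Fin.elim0 Fin.elim0
    simp at this
    exact hx this
  | succ r =>
    have hr := hmin r (Nat.lt_succ_self r)
    push Not at hr
    obtain ⟨f, g, hfg⟩ := hr
    obtain ⟨j0, hj0⟩ : ∃ j0, j0 ∉ Set.range g := by
      by_contra! h
      have hs : Function.Surjective g := h
      have := Fintype.card_le_of_surjective g hs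
      simp at this
      omega
    let g' : Fin (r + 1) → Fin n := Fin.cons j0 g
    let w : Fin (r + 1) → N := fun t =>
      ((-1) ^ (t : ℕ) * (B.submatrix f (g' ∘ t.succAbove)).det) • x
    refine ⟨fun j => ∑ t, if g' t = j then w t else 0, ?_, ?_⟩
    · intro h
      have h0 := congrFun h j0
      simp only [Pi.zero_apply] at h0
      rw [Finset.sum_eq_single 0] at h0
      · apply hfg
        have e : g' ∘ Fin.succAbove 0 = g := by
          ext t; simp [g']
        simpa [g', w, e] using h0
      · intro t _ ht
        obtain ⟨s, rfl⟩ := Fin.exists_succ_eq.2 ht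
        rw [if_neg]
        intro hs
        exact hj0 ⟨s, by simpa [g'] using hs⟩
      · simp
    · intro i
      have h := hspec (Fin.cons i f) g'
      rw [Matrix.det_succ_row_zero, Finset.sum_smul] at h
      refine Eq.trans ?_ h
      simp_rw [Finset.smul_sum]
      rw [Finset.sum_comm]
      refine Finset.sum_congr rfl fun t _ => ?_
      rw [Finset.sum_eq_single (g' t)]
      · simp only [if_true, w, smul_smul]
        congr 1
        have e : ((B.submatrix (Fin.cons i f) g').submatrix Fin.succ t.succAbove)
            = B.submatrix f (g' ∘ t.succAbove) := by
          ext a b; simp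
        rw [e]
        simp only [Matrix.submatrix_apply, Fin.cons_zero]
        ring
      · intro j _ hj
        rw [if_neg (Ne.symm hj), smul_zero]
      · simp

/-- A finitely generated faithful module has a nonzero map to each nonzero module. -/
lemma subsingleton_of_hom {R C N : Type} [CommRing R] [AddCommGroup C] [Module R C]
    [AddCommGroup N] [Module R N] [Module.Finite R C]
    (hfaith : ∀ r : R, (∀ c : C, r • c = 0) → r = 0)
    (hHom : ∀ φ : C →ₗ[R] N, φ = 0) : ∀ x : N, x = 0 := by
  intro x
  by_contra hx
  obtain ⟨n, p, hp⟩ := Module.Finite.exists_fin' R C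
  let B : Matrix (LinearMap.ker p) (Fin n) R := fun i j => i.1 j
  have hpx : ∀ u : Fin n → R, p u = ∑ j, u j • p (Pi.single j 1) := by
    intro u
    conv_lhs => rw [pi_eq_sum_univ' u]
    simp [map_sum]
  obtain ⟨v, hv, hsol⟩ := mccoy_aux B (fun f => by
    apply hfaith
    set A := B.submatrix f id with hA
    have key : ∀ j, A.det • p (Pi.single j 1) = 0 := by
      intro j
      have h1 : ∀ i, ∑ k, A i k • p (Pi.single k 1) = 0 := by
        intro i
        rw [← hpx (A i)]
        exact (f i).2
      have h2 : ∑ i, A.adjugate j i • ∑ k, A i k • p (Pi.single k 1) = 0 := by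
        simp [h1]
      simp_rw [Finset.smul_sum, smul_smul] at h2
      rw [Finset.sum_comm] at h2
      simp_rw [← Finset.sum_smul, ← Matrix.mul_apply, Matrix.adjugate_mul] at h2
      simpa [Matrix.smul_apply, Matrix.one_apply, ite_smul] using h2
    intro c
    obtain ⟨u, rfl⟩ := hp c
    rw [hpx u, Finset.smul_sum]
    refine Finset.sum_eq_zero fun j _ => ?_
    rw [smul_comm, key, smul_zero]) x hx
  let q : (Fin n → R) →ₗ[R] N := Fintype.linearCombination R v
  have hle : LinearMap.ker p ≤ LinearMap.ker q := by
    intro u hu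
    exact hsol ⟨u, hu⟩
  let φ : C →ₗ[R] N :=
    ((LinearMap.ker p).liftQ q hle).comp (p.quotKerEquivOfSurjective hp).symm.toLinearMap
  have hφ : ∀ u, φ (p u) = q u := by
    intro u
    have : (p.quotKerEquivOfSurjective hp).symm (p u) = (LinearMap.ker p).mkQ u := by
      rw [LinearEquiv.symm_apply_eq]; rfl
    simp [φ, this]
  apply hv
  ext j
  have := hφ (Pi.single j 1)
  rw [hHom φ] at this
  simpa [q, Fintype.linearCombination_apply_single] using this.symm

/-- Vanishing of `Ext^1` lets one lift along a surjection. -/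
lemma exists_lift_of_ext {R : Type} [CommRing R] (X : ModuleCat.{0} R)
    (S : ShortComplex (ModuleCat.{0} R)) (hS : S.ShortExact)
    (h : Subsingleton (((Ext R (ModuleCat.{0} R) 1).obj (Opposite.op X)).obj S.X₁))
    (f : X ⟶ S.X₃) : ∃ g : X ⟶ S.X₂, g ≫ S.g = f := by
  have := hS.mono_f
  have := hS.epi_g
  let P := projectiveResolution X
  have hz : Limits.IsZero ((P.complex.linearYonedaObj R S.X₁).homology 1) :=
    Limits.IsZero.of_iso (ModuleCat.isZero_of_subsingleton _) (P.isoExt 1 S.X₁).symm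
  rw [← HomologicalComplex.exactAt_iff_isZero_homology,
    HomologicalComplex.exactAt_iff' _ 0 1 2 (by simp) (by simp),
    ShortComplex.moduleCat_exact_iff] at hz
  obtain ⟨p, hdp, hepi, hdesc⟩ : ∃ p : P.complex.X 0 ⟶ X, P.complex.d 1 0 ≫ p = 0 ∧ Epi p ∧
      ∀ u : P.complex.X 0 ⟶ S.X₂, P.complex.d 1 0 ≫ u = 0 → ∃ g : X ⟶ S.X₂, p ≫ g = u := by
    refine ⟨P.π.f 0, P.complex_d_comp_π_f_zero, inferInstanceAs (Epi (P.π.f 0)), fun u hu => ?_⟩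
    obtain ⟨g, hg⟩ := Limits.CokernelCofork.IsColimit.desc' P.isColimitCokernelCofork _ hu
    exact ⟨g, hg⟩
  let a : P.complex.X 0 ⟶ S.X₂ := Projective.factorThru (p ≫ f) S.g
  have ha : a ≫ S.g = p ≫ f := Projective.factorThru_comp _ _
  have hk : (P.complex.d 1 0 ≫ a) ≫ S.g = 0 := by
    rw [Category.assoc, ha, ← Category.assoc, hdp, Limits.zero_comp]
  let b := hS.exact.lift _ hk
  have hb : b ≫ S.f = P.complex.d 1 0 ≫ a := hS.exact.lift_f _ hk
  have hdb : P.complex.d 2 1 ≫ b = 0 := by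
    rw [← cancel_mono S.f, Category.assoc, hb]
    simp
  obtain ⟨y, hy⟩ := hz b hdb
  let y' : P.complex.X 0 ⟶ S.X₁ := y
  have hy' : P.complex.d 1 0 ≫ y' = b := hy
  have hd : P.complex.d 1 0 ≫ (a - y' ≫ S.f) = 0 := by
    rw [Preadditive.comp_sub, ← Category.assoc, hy', hb, sub_self]
  obtain ⟨g, hg⟩ := hdesc _ hd
  refine ⟨g, ?_⟩
  rw [← cancel_epi p, ← Category.assoc, hg, Preadditive.sub_comp, ha,
    Category.assoc, S.zero, Limits.comp_zero, sub_zero]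

lemma extMod_congr {R C A B : Type} [CommRing R] [AddCommGroup C] [Module R C]
    [AddCommGroup A] [Module R A] [AddCommGroup B] [Module R B] (e : A ≃ₗ[R] B) (i : ℕ)
    (h : Subsingleton (extMod R C A i)) : Subsingleton (extMod R C B i) :=
  @Equiv.subsingleton _ _ (((Ext R (ModuleCat R) i).obj (Opposite.op (ModuleCat.of R C))).mapIso
    e.toModuleIso).toLinearEquiv.symm.toEquiv h

lemma evalNu_muMap {R C M : Type} [CommRing R] [AddCommGroup C] [Module R C]
    [AddCommGroup M] [Module R M] (φ : C →ₗ[R] M) :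
    (evalNu R C M).comp (muMap R C (C →ₗ[R] M) φ) = φ := by
  ext c
  simp [evalNu, muMap]

/-- `M` is in the Bass class `B_C` iff `Hom_R(C,M)` is in the Auslander class `A_C`. -/
theorem memBassClass_iff_hom_memAuslanderClass
    (R : Type) [CommRing R] (C : Type) [AddCommGroup C] [Module R C]
    (M : Type) [AddCommGroup M] [Module R M] (hC : IsSemidualizing R C) :
    MemBassClass R C M ↔ MemAuslanderClass R C (C →ₗ[R] M) := by
  constructor
  · rintro ⟨hE, hT, hν⟩
    let e := LinearEquiv.ofBijective (evalNu R C M) hν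
    refine ⟨hT, fun i hi => extMod_congr e.symm i (hE i hi), ?_, ?_⟩
    · intro φ ψ h
      rw [← evalNu_muMap φ, ← evalNu_muMap ψ, h]
    · intro θ
      refine ⟨(evalNu R C M).comp θ, ?_⟩
      ext c
      apply hν.1
      exact LinearMap.congr_fun (evalNu_muMap ((evalNu R C M).comp θ)) c
  · rintro ⟨hT, hE, hμ⟩
    obtain ⟨⟨P, d, ε, hfin, -, hε, -⟩, hhom, -⟩ := hC
    have := hfin 0
    have : Module.Finite R C := Module.Finite.of_surjective ε hε
    have hfaith : ∀ r : R, (∀ c : C, r • c = 0) → r = 0 := by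
      intro r hr
      apply hhom.1
      ext c
      simp [hr c]
    have hinj : Function.Injective (evalNu R C M) := by
      rw [injective_iff_map_eq_zero]
      intro t ht
      have := subsingleton_of_hom (C := C) (N := LinearMap.ker (evalNu R C M)) hfaith (by
        intro φ
        obtain ⟨ψ, hψ⟩ := hμ.2 ((LinearMap.ker (evalNu R C M)).subtype.comp φ)
        have h0 : ψ = 0 := by
          rw [← evalNu_muMap ψ, hψ]
          ext c
          exact (φ c).2
        rw [h0, map_zero] at hψ
        ext c
        exact (LinearMap.congr_fun hψ c).symm) ⟨t, ht⟩
      exact congrArg Subtype.val this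
    have hsurj : Function.Surjective (evalNu R C M) := by
      let S : ShortComplex (ModuleCat.{0} R) := ShortComplex.mk
        (ModuleCat.ofHom (evalNu R C M))
        (ModuleCat.ofHom (LinearMap.range (evalNu R C M)).mkQ) (by
          ext x
          simp)
      have hS : S.ShortExact :=
        { exact := by
            rw [ShortComplex.moduleCat_exact_iff]
            intro x hx
            have hx' : (LinearMap.range (evalNu R C M)).mkQ x = 0 := hx
            rw [Submodule.mkQ_apply, Submodule.Quotient.mk_eq_zero] at hx'
            exact hx'
          mono_f := (ModuleCat.mono_iff_injective _).2 hinj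
          epi_g := (ModuleCat.epi_iff_surjective _).2 (Submodule.mkQ_surjective _) }
      have hq := subsingleton_of_hom (C := C) (N := M ⧸ LinearMap.range (evalNu R C M)) hfaith (by
        intro φ
        obtain ⟨g, hg⟩ := exists_lift_of_ext (ModuleCat.of R C) S hS (hE 1 le_rfl)
          (ModuleCat.ofHom φ)
        have hg' : (LinearMap.range (evalNu R C M)).mkQ.comp g.hom = φ :=
          congrArg ModuleCat.Hom.hom hg
        rw [← hg']
        ext c
        have hc : g.hom c = evalNu R C M (muMap R C (C →ₗ[R] M) g.hom c) :=
          (LinearMap.congr_fun (evalNu_muMap g.hom) c).symm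
        rw [LinearMap.comp_apply, hc, Submodule.mkQ_apply, LinearMap.zero_apply,
          Submodule.Quotient.mk_eq_zero]
        exact ⟨_, rfl⟩)
      intro m
      have := hq (Submodule.Quotient.mk m)
      rwa [Submodule.Quotient.mk_eq_zero] at this
    let e := LinearEquiv.ofBijective (evalNu R C M) ⟨hinj, hsurj⟩
    exact ⟨fun i hi => extMod_congr e i (hE i hi), hT, hinj, hsurj⟩

end
end

section
/- Let R be a commutative ring, C a semidualizing R-module, and M an R-module. Then M belongs to the Auslander class A_C if and only if C ⊗_R M belongs to the Bass class B_C. -/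
open TensorProduct CategoryTheory

noncomputable section

/-- Gruson-type lemma: if `N` is generated by a finite set and `N ⊗ K = 0`, then
`K = ann(N) K`. -/
theorem aux_gruson (R : Type) [CommRing R] (C : Type) [AddCommGroup C] [Module R C]
    (K : Type) [AddCommGroup K] [Module R K] (s : Set C) (hs : s.Finite) :
    Subsingleton ((Submodule.span R s) ⊗[R] K) →
      (Submodule.span R s).annihilator • (⊤ : Submodule R K) = ⊤ := by
  induction s, hs using Set.Finite.induction_on with
  | empty =>
    intro _
    rw [Submodule.span_empty, Submodule.annihilator_bot, Submodule.top_smul]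
  | @insert c s _ _ ih =>
    intro hsub
    set N := Submodule.span R (insert c s) with hN
    set N' := Submodule.span R s with hN'
    have hle : N' ≤ N := Submodule.span_mono (Set.subset_insert c s)
    have hcN : c ∈ N := Submodule.subset_span (Set.mem_insert c s)
    let J : Ideal R := N'.colon {c}
    have hJ : ∀ j : R, j ∈ J ↔ j • c ∈ N' := fun j => Submodule.mem_colon_singleton
    have hJN : ∀ j ∈ J, ∀ x ∈ N, j • x ∈ N' := by
      intro j hj x hx
      rw [hN, Submodule.mem_span_insert] at hx
      obtain ⟨a, z, hz, rfl⟩ := hx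
      rw [smul_add, smul_comm]
      exact N'.add_mem (N'.smul_mem _ ((hJ j).1 hj)) (N'.smul_mem _ hz)
    -- K = JK
    have hK : J • (⊤ : Submodule R K) = ⊤ := by
      let φ : R →ₗ[R] (N ⧸ N'.submoduleOf N) :=
        LinearMap.toSpanSingleton R _ (Submodule.Quotient.mk ⟨c, hcN⟩)
      have hφ : Function.Surjective φ := by
        intro y
        obtain ⟨⟨x, hx⟩, rfl⟩ := Submodule.Quotient.mk_surjective _ y
        have hx' := hx
        rw [hN, Submodule.mem_span_insert] at hx'
        obtain ⟨a, z, hz, rfl⟩ := hx'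
        refine ⟨a, ?_⟩
        simp only [φ, LinearMap.toSpanSingleton_apply]
        rw [← Submodule.Quotient.mk_smul, Submodule.Quotient.eq]
        simp only [Submodule.submoduleOf, Submodule.mem_comap]
        simpa using hz
      have hker : LinearMap.ker φ = J := by
        ext j
        rw [hJ, LinearMap.mem_ker]
        simp only [φ, LinearMap.toSpanSingleton_apply]
        rw [← Submodule.Quotient.mk_smul, Submodule.Quotient.mk_eq_zero]
        simp [Submodule.submoduleOf]
      have h1 : Subsingleton ((N ⧸ N'.submoduleOf N) ⊗[R] K) :=
        (LinearMap.rTensor_surjective K (Submodule.mkQ_surjective (N'.submoduleOf N))).subsingleton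
      have h2 : Subsingleton ((R ⧸ LinearMap.ker φ) ⊗[R] K) :=
        (TensorProduct.congr (φ.quotKerEquivOfSurjective hφ)
          (LinearEquiv.refl R K)).toEquiv.subsingleton
      rw [hker] at h2
      have h3 : Subsingleton (K ⧸ (J • (⊤ : Submodule R K))) :=
        (TensorProduct.quotTensorEquivQuotSMul K J).symm.toEquiv.subsingleton
      exact Submodule.Quotient.subsingleton_iff.1 h3
    have hsub' : Subsingleton (N' ⊗[R] K) := by
      refine subsingleton_of_forall_eq 0 fun t => ?_
      induction t with
      | zero => rfl
      | add x y hx hy => rw [hx, hy, add_zero]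
      | tmul x k =>
        have hk : k ∈ J • (⊤ : Submodule R K) := by rw [hK]; trivial
        refine Submodule.smul_induction_on hk ?_ ?_
        · intro j hj k _
          let m : N →ₗ[R] N' := LinearMap.codRestrict N' (j • N.subtype)
            (fun y => hJN j hj y y.2)
          have e : x ⊗ₜ[R] (j • k) = LinearMap.rTensor K m ((⟨x, hle x.2⟩ : N) ⊗ₜ[R] k) := by
            rw [LinearMap.rTensor_tmul, ← TensorProduct.smul_tmul]
            rfl
          rw [e, Subsingleton.elim ((⟨x, hle x.2⟩ : N) ⊗ₜ[R] k) 0, map_zero]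
        · intro a b ha hb
          rw [TensorProduct.tmul_add, ha, hb, add_zero]
    have hK' := ih hsub'
    rw [eq_top_iff]
    calc (⊤ : Submodule R K) = J • (N'.annihilator • (⊤ : Submodule R K)) := by rw [hK', hK]
      _ = (J * N'.annihilator) • (⊤ : Submodule R K) := by rw [← Submodule.mul_smul]
      _ ≤ _ := by
        refine Submodule.smul_mono_left ?_
        rw [Ideal.mul_le]
        intro j hj a ha
        rw [Submodule.mem_annihilator] at ha ⊢
        intro x hx
        rw [mul_comm, mul_smul]
        exact ha _ (hJN j hj x hx)

theorem aux_faithful (R : Type) [CommRing R] (C : Type) [AddCommGroup C] [Module R C]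
    (K : Type) [AddCommGroup K] [Module R K] [Module.Finite R C]
    (hf : ∀ r : R, (∀ c : C, r • c = 0) → r = 0) (h : Subsingleton (C ⊗[R] K)) :
    Subsingleton K := by
  obtain ⟨s, hs⟩ := (Module.finite_def.1 ‹Module.Finite R C› : (⊤ : Submodule R C).FG)
  have h1 := aux_gruson R C K s s.finite_toSet
  rw [hs] at h1
  have h2 := h1 (TensorProduct.congr (Submodule.topEquiv (R := R) (M := C))
    (LinearEquiv.refl R K)).toEquiv.subsingleton
  have h3 : (⊤ : Submodule R C).annihilator = ⊥ := by
    rw [eq_bot_iff]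
    intro r hr
    rw [Submodule.mem_annihilator] at hr
    exact hf r fun c => hr c trivial
  rw [h3, Submodule.bot_smul] at h2
  exact (Submodule.subsingleton_iff R).1 (subsingleton_of_bot_eq_top h2)

theorem aux_tor (R : Type) [CommRing R] (C : Type) [AddCommGroup C] [Module R C]
    (H : Type) [AddCommGroup H] [Module R H] (h : Subsingleton (torMod R C H 1)) :
    ∃ (P₂ P₁ P₀ : ModuleCat.{0} R) (d₂ : P₂ →ₗ[R] P₁) (d₁ : P₁ →ₗ[R] P₀) (π : P₀ →ₗ[R] H),
      Module.Projective R P₀ ∧ Function.Surjective π ∧ Function.Exact d₁ π ∧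
      Function.Exact d₂ d₁ ∧ Function.Exact (d₂.lTensor C) (d₁.lTensor C) := by
  let P := projectiveResolution (ModuleCat.of R H)
  let F := (MonoidalCategory.tensoringLeft (ModuleCat.{0} R)).obj (ModuleCat.of R C)
  have hz : Limits.IsZero ((F.leftDerived 1).obj (ModuleCat.of R H)) :=
    @ModuleCat.isZero_of_subsingleton _ _ _ h
  have hz' := hz.of_iso (P.isoLeftDerivedObj F 1).symm
  have hex : ((F.mapHomologicalComplex _).obj P.complex).ExactAt 1 :=
    (HomologicalComplex.exactAt_iff_isZero_homology _ _).2 hz'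
  rw [HomologicalComplex.exactAt_iff' _ 2 1 0 (by simp) (by simp),
    ShortComplex.ShortExact.moduleCat_exact_iff_function_exact] at hex
  have hex1 := P.exact_succ 0
  rw [ShortComplex.ShortExact.moduleCat_exact_iff_function_exact] at hex1
  have hex0 := P.exact₀
  rw [ShortComplex.ShortExact.moduleCat_exact_iff_function_exact] at hex0
  have hepi : Epi (P.π.f 0) := inferInstance
  rw [ModuleCat.epi_iff_surjective] at hepi
  refine ⟨P.complex.X 2, P.complex.X 1, P.complex.X 0, (P.complex.d 2 1).hom,
    (P.complex.d 1 0).hom, (P.π.f 0).hom, ?_, hepi, hex0, hex1, hex⟩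
  exact (IsProjective.iff_projective (P.complex.X 0)).2 (P.projective 0)

/-- If `Tor₁(C,H) = 0` then tensoring a short exact sequence ending in `H` preserves injectivity. -/
theorem aux_inj (R : Type) [CommRing R] (C : Type) [AddCommGroup C] [Module R C]
    (H : Type) [AddCommGroup H] [Module R H] (h : Subsingleton (torMod R C H 1))
    (M : Type) [AddCommGroup M] [Module R M] (g : M →ₗ[R] H) (hg : Function.Surjective g) :
    Function.Injective ((LinearMap.ker g).subtype.lTensor C) := by
  obtain ⟨P₂, P₁, P₀, d₂, d₁, π, hP, hπ, h0, h1, ht⟩ := aux_tor R C H h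
  obtain ⟨f, hf⟩ := Module.projective_lifting_property g π hg
  have hf' : ∀ x, g (f x) = π x := fun x => LinearMap.congr_fun hf x
  let N := LinearMap.ker g
  let e : P₁ →ₗ[R] N := LinearMap.codRestrict N (f ∘ₗ d₁) (fun x => by
    simp only [N, LinearMap.mem_ker, LinearMap.comp_apply, hf']
    exact (h0 _).2 ⟨x, rfl⟩)
  let a : P₁ →ₗ[R] (N × P₀) := LinearMap.prod (-e) d₁
  let b : (N × P₀) →ₗ[R] M := LinearMap.coprod N.subtype f
  have hb : Function.Surjective b := by
    intro m
    obtain ⟨p, hp⟩ := hπ (g m)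
    refine ⟨(⟨m - f p, by simp [N, hf', hp]⟩, p), by simp [b]⟩
  have hab : Function.Exact a b := by
    rintro ⟨⟨n, hn⟩, p⟩
    constructor
    · intro hx
      simp only [b, LinearMap.coprod_apply, Submodule.subtype_apply] at hx
      have hp : π p = 0 := by
        rw [← hf', ← zero_add (g (f p)), ← (LinearMap.mem_ker.1 hn), ← map_add, hx, map_zero]
        exact (LinearMap.mem_ker.1 hn).symm
      obtain ⟨q, rfl⟩ := (h0 p).1 hp
      refine ⟨q, Prod.ext (Subtype.ext ?_) rfl⟩
      simp only [a, e, LinearMap.prod_apply]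
      exact (eq_neg_of_add_eq_zero_left hx).symm
    · rintro ⟨q, hq⟩
      rw [← hq]
      simp [a, b, e]
  have hT := lTensor_exact C hab hb
  rw [injective_iff_map_eq_zero]
  intro t htz
  have h2 : b.lTensor C ((LinearMap.inl R N P₀).lTensor C t) = 0 := by
    rw [← LinearMap.comp_apply, ← LinearMap.lTensor_comp]
    have : b ∘ₗ LinearMap.inl R N P₀ = N.subtype := by simp [b]
    rw [this]; exact htz
  obtain ⟨w, hw⟩ := (hT _).1 h2
  have h3 : d₁.lTensor C w = 0 := by
    have := congrArg ((LinearMap.snd R N P₀).lTensor C) hw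
    rw [← LinearMap.comp_apply, ← LinearMap.lTensor_comp, ← LinearMap.comp_apply,
      ← LinearMap.lTensor_comp] at this
    simpa [a] using this
  obtain ⟨v, rfl⟩ := (ht _).1 h3
  have h4 : a ∘ₗ d₂ = 0 := by
    have : d₁ ∘ₗ d₂ = 0 := h1.linearMap_comp_eq_zero
    have h5 : ∀ x, d₁ (d₂ x) = 0 := fun x => LinearMap.congr_fun this x
    ext x
    · simp [a, e, h5]
    · simp [a, h5]
  rw [← LinearMap.comp_apply, ← LinearMap.lTensor_comp, h4] at hw
  have h6 := congrArg ((LinearMap.fst R N P₀).lTensor C) hw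
  rw [← LinearMap.comp_apply ((LinearMap.fst R N P₀).lTensor C) ((LinearMap.inl R N P₀).lTensor C),
    ← LinearMap.lTensor_comp, LinearMap.fst_comp_inl] at h6
  simpa using h6.symm

theorem aux_nu_mu (R : Type) [CommRing R] (C : Type) [AddCommGroup C] [Module R C]
    (M : Type) [AddCommGroup M] [Module R M] :
    (evalNu R C (C ⊗[R] M)) ∘ₗ ((muMap R C M).lTensor C) = LinearMap.id := by
  ext c m
  simp [evalNu, muMap]

theorem aux_tor_congr (R : Type) [CommRing R] (C : Type) [AddCommGroup C] [Module R C]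
    (A B : Type) [AddCommGroup A] [Module R A] [AddCommGroup B] [Module R B]
    (e : A ≃ₗ[R] B) (i : ℕ) (h : Subsingleton (torMod R C A i)) :
    Subsingleton (torMod R C B i) := by
  have h1 : Limits.IsZero (torMod R C A i) := @ModuleCat.isZero_of_subsingleton _ _ _ h
  exact ModuleCat.subsingleton_of_isZero
    (h1.of_iso (((Tor (ModuleCat R) i).obj (ModuleCat.of R C)).mapIso e.toModuleIso.symm))

theorem aux_mu_bij (R : Type) [CommRing R] (C : Type) [AddCommGroup C] [Module R C]
    (M : Type) [AddCommGroup M] [Module R M] (hC : IsSemidualizing R C)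
    (hT : Subsingleton (torMod R C (C →ₗ[R] (C ⊗[R] M)) 1))
    (hμ : Function.Bijective ((muMap R C M).lTensor C)) :
    Function.Bijective (muMap R C M) := by
  obtain ⟨⟨P, d, ε, hfin, -, hε, -, -⟩, hhom, -⟩ := hC
  have := hfin 0
  have : Module.Finite R C := Module.Finite.of_surjective ε hε
  have hf : ∀ r : R, (∀ c : C, r • c = 0) → r = 0 := by
    intro r hr
    apply hhom.1
    ext c
    simpa using hr c
  have hsurj : Function.Surjective (muMap R C M) := by
    let μ := muMap R C M
    have hex : Function.Exact μ (LinearMap.range μ).mkQ := LinearMap.exact_map_mkQ_range μ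
    have hq := Submodule.mkQ_surjective (LinearMap.range μ)
    have hT' := lTensor_exact C hex hq
    have : Subsingleton (C ⊗[R] ((C →ₗ[R] (C ⊗[R] M)) ⧸ LinearMap.range μ)) := by
      refine subsingleton_of_forall_eq 0 fun t => ?_
      obtain ⟨u, rfl⟩ := LinearMap.lTensor_surjective C hq t
      exact (hT' u).2 (hμ.2 u)
    have h2 := aux_faithful R C _ hf this
    exact LinearMap.range_eq_top.1 (Submodule.Quotient.subsingleton_iff.1 h2)
  refine ⟨?_, hsurj⟩
  have hinj := aux_inj R C _ hT M (muMap R C M) hsurj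
  have : Subsingleton (C ⊗[R] (LinearMap.ker (muMap R C M))) := by
    refine subsingleton_of_forall_eq 0 fun t => ?_
    apply hinj
    apply hμ.1
    rw [← LinearMap.comp_apply, ← LinearMap.lTensor_comp, LinearMap.comp_ker_subtype]
    simp
  have h2 := aux_faithful R C _ hf this
  rw [← LinearMap.ker_eq_bot]
  exact (Submodule.subsingleton_iff_eq_bot).1 h2

/-- `M` is in the Auslander class `A_C` iff `C ⊗_R M` is in the Bass class `B_C`. -/
theorem memAuslanderClass_iff_tensor_memBassClass
    (R : Type) [CommRing R] (C : Type) [AddCommGroup C] [Module R C]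
    (M : Type) [AddCommGroup M] [Module R M] (hC : IsSemidualizing R C) :
    MemAuslanderClass R C M ↔ MemBassClass R C (C ⊗[R] M) := by
  have hid : ∀ x, evalNu R C (C ⊗[R] M) ((muMap R C M).lTensor C x) = x :=
    fun x => LinearMap.congr_fun (aux_nu_mu R C M) x
  constructor
  · rintro ⟨h1, h2, h3⟩
    let e := LinearEquiv.ofBijective (muMap R C M) h3
    refine ⟨h2, fun i hi => aux_tor_congr R C _ _ e i (h1 i hi), ?_⟩
    have hb : Function.Bijective ((muMap R C M).lTensor C) := (e.lTensor C).bijective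
    constructor
    · intro x y hxy
      obtain ⟨x, rfl⟩ := hb.2 x
      obtain ⟨y, rfl⟩ := hb.2 y
      rw [hid, hid] at hxy
      rw [hxy]
    · exact fun x => ⟨_, hid x⟩
  · rintro ⟨h1, h2, h3⟩
    have hb : Function.Bijective ((muMap R C M).lTensor C) := by
      constructor
      · intro x y hxy
        rw [← hid x, hxy, hid]
      · intro x
        exact ⟨evalNu R C (C ⊗[R] M) x, h3.1 (hid _)⟩
    have hμ := aux_mu_bij R C M hC (h2 1 le_rfl) hb
    exact ⟨fun i hi => aux_tor_congr R C _ _ (LinearEquiv.ofBijective _ hμ).symm i (h2 i hi),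
      h1, hμ⟩

end
end

section
/- Let R be a commutative ring, C a semidualizing R-module, and M an R-module. If M admits a bounded augmented proper P_C-projective resolution, i.e., an augmented proper P_C-projective resolution X⁺ : ⋯ → C ⊗_R P_1 → C ⊗_R P_0 → M → 0 with C ⊗_R P_i = 0 for all i greater than some n, then M belongs to the Bass class B_C. -/
open TensorProduct CategoryTheory

noncomputable section

section CatPart

variable {R : Type} [CommRing R]

/-- a projective resolution from elementary data -/
theorem exists_projRes_s8 (Z : Type) [AddCommGroup Z] [Module R Z]
    (P : ℕ → ModuleCat.{0} R) (d : ∀ n, ↥(P (n + 1)) →ₗ[R] ↥(P n)) (ε : ↥(P 0) →ₗ[R] Z)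
    (hP : ∀ n, Module.Projective R ↥(P n))
    (hε : Function.Surjective ε) (h0 : Function.Exact (d 0) ε)
    (h : ∀ n, Function.Exact (d (n + 1)) (d n)) :
    ∃ (T : ProjectiveResolution (ModuleCat.of R Z))
      (sq : ∀ n, ModuleCat.ofHom (d (n + 1)) ≫ ModuleCat.ofHom (d n) = 0),
      T.complex = ChainComplex.of P (fun n => ModuleCat.ofHom (d n)) sq := by
  have sq : ∀ n, ModuleCat.ofHom (d (n + 1)) ≫ ModuleCat.ofHom (d n) = 0 := by
    intro n
    ext x
    exact (h n).apply_apply_eq_zero x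
  let K : ChainComplex (ModuleCat.{0} R) ℕ :=
    ChainComplex.of P (fun n => ModuleCat.ofHom (d n)) sq
  have hKd : ∀ n, K.d (n + 1) n = ModuleCat.ofHom (d n) := fun n => ChainComplex.of_d P (fun n => ModuleCat.ofHom (d n)) n
  have w : K.d 1 0 ≫ (ModuleCat.ofHom ε : P 0 ⟶ ModuleCat.of R Z) = 0 := by
    rw [hKd 0]
    ext x
    exact h0.apply_apply_eq_zero x
  let π : K ⟶ (ChainComplex.single₀ (ModuleCat.{0} R)).obj (ModuleCat.of R Z) :=
    (ChainComplex.toSingle₀Equiv K (ModuleCat.of R Z)).symm ⟨ModuleCat.ofHom ε, w⟩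
  have hπ : π.f 0 = ModuleCat.ofHom ε := ChainComplex.toSingle₀Equiv_symm_apply_f_zero _ w
  have hexact : ∀ n, K.ExactAt (n + 1) := by
    intro n
    rw [HomologicalComplex.exactAt_iff' _ (n + 1 + 1) (n + 1) n (by simp) (by simp),
      ShortComplex.moduleCat_exact_iff]
    intro x hx
    change K.d (n + 1) n x = 0 at hx
    rw [hKd] at hx
    obtain ⟨y, hy⟩ := (h n x).1 hx
    refine ⟨y, ?_⟩
    change K.d (n + 1 + 1) (n + 1) y = x
    rw [hKd]
    exact hy
  have hq : QuasiIso π := by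
    refine ⟨fun n => ?_⟩
    cases n with
    | zero =>
      rw [ChainComplex.quasiIsoAt₀_iff, ShortComplex.quasiIso_iff_of_zeros' _ (by simp; rfl) rfl rfl]
      constructor
      · rw [ShortComplex.moduleCat_exact_iff]
        intro x hx
        change π.f 0 x = 0 at hx
        rw [hπ] at hx
        obtain ⟨y, hy⟩ := (h0 x).1 hx
        refine ⟨y, ?_⟩
        change K.d 1 0 y = x
        rw [hKd 0]
        exact hy
      · change Epi (π.f 0)
        rw [hπ]
        exact (ModuleCat.epi_iff_surjective (ModuleCat.ofHom ε)).2 hε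
    | succ n =>
      rw [quasiIsoAt_iff_exactAt']
      · exact hexact n
      · apply ChainComplex.exactAt_succ_single_obj
  refine ⟨{ complex := K, projective := fun n => ?_, π := π, quasiIso := hq }, sq, rfl⟩
  exact (IsProjective.iff_projective (P n)).1 (hP n)

theorem ext_iff_acyc (Z : Type) [AddCommGroup Z] [Module R Z]
    (P : ℕ → ModuleCat.{0} R) (d : ∀ n, ↥(P (n + 1)) →ₗ[R] ↥(P n)) (ε : ↥(P 0) →ₗ[R] Z)
    (hP : ∀ n, Module.Projective R ↥(P n))
    (hε : Function.Surjective ε) (h0 : Function.Exact (d 0) ε)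
    (h : ∀ n, Function.Exact (d (n + 1)) (d n))
    (B : Type) [AddCommGroup B] [Module R B] (i : ℕ) :
    Subsingleton (extMod R Z B (i + 1)) ↔
      ∀ g : ↥(P (i + 1)) →ₗ[R] B, g ∘ₗ d (i + 1) = 0 → ∃ k : ↥(P i) →ₗ[R] B, g = k ∘ₗ d i := by
  obtain ⟨T, sq, hT⟩ := exists_projRes_s8 Z P d ε hP hε h0 h
  rw [← ModuleCat.isZero_iff_subsingleton, extMod, (T.isoExt (i + 1) _).isZero_iff, hT,
    ← HomologicalComplex.exactAt_iff_isZero_homology,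
    HomologicalComplex.exactAt_iff' _ i (i + 1) (i + 1 + 1) (by simp) (by simp),
    ShortComplex.moduleCat_exact_iff]
  let K : ChainComplex (ModuleCat.{0} R) ℕ :=
    ChainComplex.of P (fun n => ModuleCat.ofHom (d n)) sq
  have hKd : ∀ n, K.d (n + 1) n = ModuleCat.ofHom (d n) := fun n => ChainComplex.of_d P (fun n => ModuleCat.ofHom (d n)) n
  constructor
  · intro H g hg
    obtain ⟨k, hk⟩ := H (ModuleCat.ofHom g : P (i + 1) ⟶ ModuleCat.of R B) (by
      change K.d (i + 1 + 1) (i + 1) ≫ (ModuleCat.ofHom g : P (i + 1) ⟶ ModuleCat.of R B) = 0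
      rw [hKd]
      ext x
      exact LinearMap.congr_fun hg x)
    change K.d (i + 1) i ≫ (k : P i ⟶ ModuleCat.of R B) = ModuleCat.ofHom g at hk
    rw [hKd] at hk
    refine ⟨ModuleCat.Hom.hom (k : P i ⟶ ModuleCat.of R B), ?_⟩
    have := congrArg ModuleCat.Hom.hom hk
    exact this.symm
  · intro H g hg
    change K.d (i + 1 + 1) (i + 1) ≫ (g : P (i + 1) ⟶ ModuleCat.of R B) = 0 at hg
    rw [hKd] at hg
    obtain ⟨k, hk⟩ := H (ModuleCat.Hom.hom (g : P (i + 1) ⟶ ModuleCat.of R B))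
      (congrArg ModuleCat.Hom.hom hg)
    refine ⟨(ModuleCat.ofHom k : P i ⟶ ModuleCat.of R B), ?_⟩
    change K.d (i + 1) i ≫ (ModuleCat.ofHom k : P i ⟶ ModuleCat.of R B) = g
    rw [hKd]
    apply ModuleCat.hom_ext
    exact hk.symm

theorem tor_zero (Z : Type) [AddCommGroup Z] [Module R Z]
    (P : ℕ → ModuleCat.{0} R) (d : ∀ n, ↥(P (n + 1)) →ₗ[R] ↥(P n)) (ε : ↥(P 0) →ₗ[R] Z)
    (hP : ∀ n, Module.Projective R ↥(P n))
    (hε : Function.Surjective ε) (h0 : Function.Exact (d 0) ε)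
    (h : ∀ n, Function.Exact (d (n + 1)) (d n))
    (C : Type) [AddCommGroup C] [Module R C] (i : ℕ)
    (hX : Function.Exact ((d (i + 1)).lTensor C) ((d i).lTensor C)) :
    Subsingleton (torMod R C Z (i + 1)) := by
  obtain ⟨T, sq, hT⟩ := exists_projRes_s8 Z P d ε hP hε h0 h
  rw [← ModuleCat.isZero_iff_subsingleton, torMod]
  refine Limits.IsZero.of_iso ?_ (T.isoLeftDerivedObj _ (i + 1))
  change Limits.IsZero (HomologicalComplex.homology _ _)
  rw [hT, ← HomologicalComplex.exactAt_iff_isZero_homology,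
    HomologicalComplex.exactAt_iff' _ (i + 1 + 1) (i + 1) i (by simp) (by simp),
    ShortComplex.moduleCat_exact_iff]
  let K : ChainComplex (ModuleCat.{0} R) ℕ :=
    ChainComplex.of P (fun n => ModuleCat.ofHom (d n)) sq
  have hKd : ∀ n, K.d (n + 1) n = ModuleCat.ofHom (d n) := fun n => ChainComplex.of_d P (fun n => ModuleCat.ofHom (d n)) n
  intro x hx
  change (((MonoidalCategory.tensoringLeft (ModuleCat R)).obj (ModuleCat.of R C)).map
    (K.d (i + 1) i)) x = 0 at hx
  rw [hKd] at hx
  obtain ⟨y, hy⟩ := (hX x).1 hx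
  refine ⟨y, ?_⟩
  change (((MonoidalCategory.tensoringLeft (ModuleCat R)).obj (ModuleCat.of R C)).map
    (K.d (i + 1 + 1) (i + 1))) y = x
  rw [hKd]
  exact hy

end CatPart
section AlgPart

variable {R : Type} [CommRing R]

/-- McCoy-type argument: a finitely generated faithful module `C` has a nonzero
homomorphism to every nonzero module. -/
theorem subsingleton_of_hom_eq_zero (C : Type) [AddCommGroup C] [Module R C] [Module.Finite R C]
    (hfaith : ∀ r : R, (∀ c : C, r • c = 0) → r = 0)
    (N : Type) [AddCommGroup N] [Module R N] (hN : ∀ f : C →ₗ[R] N, f = 0) :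
    ∀ x : N, x = 0 := by
  intro x
  by_contra hx
  obtain ⟨n, f, hf⟩ := Module.Finite.exists_fin' R C
  have key : ∀ r : ℕ, r ≤ n → ∃ (k : Fin r → (Fin n → R)) (s : Fin r → Fin n),
      (∀ a, f (k a) = 0) ∧ Function.Injective s ∧
      (Matrix.of (fun a b => k a (s b))).det • x ≠ 0 := by
    intro r
    induction r with
    | zero =>
      intro _
      exact ⟨fun a => a.elim0, fun a => a.elim0, fun a => a.elim0, fun a => a.elim0, by simpa using hx⟩
    | succ r ih =>
      intro hr
      obtain ⟨k, s, hk, hs, hdet⟩ := ih (by omega)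
      obtain ⟨j, hj⟩ : ∃ j, j ∉ Set.range s := by
        by_contra hcon
        push Not at hcon
        have hsurj : Function.Surjective s := hcon
        have := Fintype.card_le_of_surjective s hsurj
        simp at this
        omega
      let s' : Fin (r + 1) → Fin n := Fin.cons j s
      let k' : (Fin n → R) → Fin (r + 1) → (Fin n → R) := fun v => Fin.cons v k
      -- linear map
      let A : Matrix (Fin (r + 1)) (Fin (r + 1)) R := Matrix.of (fun a b => k' 0 a (s' b))
      have hA : ∀ v, Matrix.of (fun a b => k' v a (s' b)) = A.updateRow 0 (fun b => v (s' b)) := by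
        intro v
        ext a b
        refine Fin.cases ?_ (fun a => ?_) a
        · simp [k']
        · simp [A, k', Matrix.updateRow_apply]
      let φ : (Fin n → R) →ₗ[R] N :=
        { toFun := fun v => (Matrix.of (fun a b => k' v a (s' b))).det • x
          map_add' := by
            intro v w
            rw [hA, hA, hA, ← add_smul, ← Matrix.det_updateRow_add]
            rfl
          map_smul' := by
            intro c v
            rw [hA, hA, RingHom.id_apply, smul_smul, ← Matrix.det_updateRow_smul]
            rfl }
      have hφ : φ (Pi.single j 1) ≠ 0 := by
        change (Matrix.of (fun a b => k' (Pi.single j 1) a (s' b))).det • x ≠ 0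
        have : (Matrix.of (fun a b => k' (Pi.single j 1) a (s' b))).det
            = (Matrix.of (fun a b => k a (s b))).det := by
          rw [Matrix.det_succ_row_zero, Fin.sum_univ_succ, Finset.sum_eq_zero]
          · simp only [k', s', Matrix.of_apply, Fin.cons_zero, Pi.single_eq_same]
            simp
            rfl
          · intro b _
            have hne : s b ≠ j := fun h => hj ⟨b, h⟩
            simp [k', s', hne]
        rwa [this]
      have hv : ∃ v, f v = 0 ∧ φ v ≠ 0 := by
        by_contra hcon
        push Not at hcon
        have hle : LinearMap.ker f ≤ LinearMap.ker φ := fun v hv => hcon v hv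
        let g : C →ₗ[R] N := (LinearMap.ker f).liftQ φ hle ∘ₗ
          (f.quotKerEquivOfSurjective hf).symm.toLinearMap
        have hg : g (f (Pi.single j 1)) = φ (Pi.single j 1) := by
          have : (f.quotKerEquivOfSurjective hf).symm (f (Pi.single j 1))
              = (LinearMap.ker f).mkQ (Pi.single j 1) := by
            rw [LinearEquiv.symm_apply_eq]; rfl
          simp only [g, LinearMap.comp_apply, LinearEquiv.coe_coe, this]
          rfl
        rw [hN g] at hg
        exact hφ hg.symm
      obtain ⟨v, hv0, hv1⟩ := hv
      refine ⟨k' v, s', ?_, ?_, hv1⟩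
      · intro a
        refine Fin.cases ?_ (fun a => ?_) a
        · simpa [k'] using hv0
        · simpa [k'] using hk a
      · exact Fin.cons_injective_iff.2 ⟨hj, hs⟩
  obtain ⟨k, s, hk, hs, hdet⟩ := key n le_rfl
  apply hdet
  have hbij : Function.Bijective s := Finite.injective_iff_bijective.1 hs
  let e := Equiv.ofBijective s hbij
  set A : Matrix (Fin n) (Fin n) R := Matrix.of (fun a b => k a (s b)) with hAdef
  have h1 : ∀ a, ∑ b, A a b • f (Pi.single (s b) 1) = 0 := by
    intro a
    rw [← hk a, LinearMap.pi_apply_eq_sum_univ f (k a),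
      ← e.sum_comp (fun i => k a i • f (fun j => if i = j then 1 else 0))]
    refine Finset.sum_congr rfl fun b _ => ?_
    have : (Pi.single (s b) 1 : Fin n → R) = fun j => if e b = j then 1 else 0 := by
      funext j
      simp [Pi.single_apply, e, eq_comm]
    rw [this]
    rfl
  have h2 : ∀ b, A.det • f (Pi.single (s b) 1) = 0 := by
    intro b
    have : ∑ a, A.adjugate b a • ∑ b', A a b' • f (Pi.single (s b') 1) = 0 := by
      simp [h1]
    simp only [Finset.smul_sum, smul_smul] at this
    rw [Finset.sum_comm] at this
    simp only [← Finset.sum_smul, ← Matrix.mul_apply, Matrix.adjugate_mul] at this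
    simpa [Matrix.smul_apply, Matrix.one_apply] using this
  have h3 : A.det = 0 := by
    apply hfaith
    intro c
    obtain ⟨v, rfl⟩ := hf c
    have : A.det • f = 0 := by
      refine LinearMap.pi_ext' fun i => ?_
      ext
      obtain ⟨b, rfl⟩ := hbij.2 i
      simpa using h2 b
    exact LinearMap.congr_fun this v
  rw [h3, zero_smul]

end AlgPart
section AcycPart

variable {R : Type} [CommRing R]

/-- `Hom(Q, B)` is exact in positive degrees. -/
def Acyc (Q : ℕ → ModuleCat.{0} R) (dQ : ∀ n, ↥(Q (n + 1)) →ₗ[R] ↥(Q n))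
    (B : Type) [AddCommGroup B] [Module R B] : Prop :=
  ∀ (i : ℕ) (g : ↥(Q (i + 1)) →ₗ[R] B), g ∘ₗ dQ (i + 1) = 0 →
    ∃ k : ↥(Q i) →ₗ[R] B, g = k ∘ₗ dQ i

variable {Q : ℕ → ModuleCat.{0} R} {dQ : ∀ n, ↥(Q (n + 1)) →ₗ[R] ↥(Q n)}
variable {B B' : Type} [AddCommGroup B] [Module R B] [AddCommGroup B'] [Module R B']
variable {C : Type} [AddCommGroup C] [Module R C]

theorem Acyc.retract (i : B →ₗ[R] B') (p : B' →ₗ[R] B) (hpi : p ∘ₗ i = LinearMap.id)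
    (h : Acyc Q dQ B') : Acyc Q dQ B := by
  intro n g hg
  obtain ⟨k, hk⟩ := h n (i ∘ₗ g) (by rw [LinearMap.comp_assoc, hg, LinearMap.comp_zero])
  refine ⟨p ∘ₗ k, ?_⟩
  rw [LinearMap.comp_assoc, ← hk, ← LinearMap.comp_assoc, hpi, LinearMap.id_comp]

theorem exists_finset_support {ι : Type} [Module.Finite R B] (g : B →ₗ[R] (ι →₀ B')) :
    ∃ S : Finset ι, ∀ a ∉ S, ∀ b, g b a = 0 := by
  classical
  obtain ⟨T, hT⟩ := (Module.Finite.fg_top : (⊤ : Submodule R B).FG)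
  refine ⟨T.biUnion fun t => (g t).support, fun a ha b => ?_⟩
  have hle : (⊤ : Submodule R B) ≤ LinearMap.ker ((Finsupp.lapply a : (ι →₀ B') →ₗ[R] B') ∘ₗ g) := by
    rw [← hT, Submodule.span_le]
    intro t ht
    have : a ∉ (g t).support := fun h => ha (Finset.mem_biUnion.2 ⟨t, ht, h⟩)
    simpa using this
  exact hle (Submodule.mem_top : b ∈ _)

theorem Acyc.finsupp (hQ : ∀ n, Module.Finite R ↥(Q n)) (h : Acyc Q dQ B) (ι : Type) :
    Acyc Q dQ (ι →₀ B) := by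
  classical
  intro n g hg
  obtain ⟨S, hS⟩ := exists_finset_support g
  have : ∀ a : ι, ∃ k : ↥(Q n) →ₗ[R] B, (Finsupp.lapply a : (ι →₀ B) →ₗ[R] B) ∘ₗ g = k ∘ₗ dQ n := by
    intro a
    apply h n
    rw [LinearMap.comp_assoc, hg, LinearMap.comp_zero]
  choose k hk using this
  refine ⟨∑ a ∈ S, Finsupp.lsingle a ∘ₗ k a, ?_⟩
  ext q b
  have hb : ∀ a, k a (dQ n q) = g q a := fun a => (LinearMap.congr_fun (hk a) q).symm
  simp only [LinearMap.comp_apply, LinearMap.sum_apply, Finsupp.lsingle_apply, hb,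
    Finsupp.finsetSum_apply, Finsupp.single_apply, Finset.sum_ite_eq']
  split_ifs with hbS
  · rfl
  · exact hS b hbS q

theorem exists_retract (P : Type) [AddCommGroup P] [Module R P] [Module.Projective R P] :
    ∃ (s : P →ₗ[R] (P →₀ R)) (p : (P →₀ R) →ₗ[R] P), p ∘ₗ s = LinearMap.id := by
  obtain ⟨s, hs⟩ := (Module.projective_def' (R := R) (P := P)).1 inferInstance
  exact ⟨s, _, hs⟩

theorem Acyc.tensor (hQ : ∀ n, Module.Finite R ↥(Q n)) (h : Acyc Q dQ C)
    (P : Type) [AddCommGroup P] [Module R P] [Module.Projective R P] :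
    Acyc Q dQ (C ⊗[R] P) := by
  classical
  obtain ⟨s, p, hps⟩ := exists_retract (R := R) P
  refine Acyc.retract (s.lTensor C) (p.lTensor C) ?_ ?_
  · rw [← LinearMap.lTensor_comp, hps, LinearMap.lTensor_id]
  · let e := TensorProduct.finsuppScalarRight R R C P
    refine Acyc.retract e.toLinearMap e.symm.toLinearMap ?_ (h.finsupp hQ P)
    ext x
    simp

theorem mu_bijective [Module.Finite R C]
    (hbij : Function.Bijective (fun r : R => (r • LinearMap.id : C →ₗ[R] C)))
    (P : Type) [AddCommGroup P] [Module R P] [Module.Projective R P] :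
    Function.Bijective (muMap R C P) := by
  classical
  obtain ⟨s, p, hps⟩ := exists_retract (R := R) P
  let e := TensorProduct.finsuppScalarRight R R C P
  have he : ∀ (r : P →₀ R) (c : C) (a : P), e (c ⊗ₜ r) a = r a • c := by
    intro r c a
    simp [e]
  have inj : Function.Injective (muMap R C (P →₀ R)) := by
    intro r r' hr
    ext a
    apply hbij.1
    ext c
    have := DFunLike.congr_fun (congrArg e (LinearMap.congr_fun hr c)) a
    change e (c ⊗ₜ r) a = e (c ⊗ₜ r') a at this
    simpa [he] using this
  have surj : Function.Surjective (muMap R C (P →₀ R)) := by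
    intro g
    obtain ⟨S, hS⟩ := exists_finset_support (e.toLinearMap ∘ₗ g)
    have : ∀ a : P, ∃ r : R, ∀ c, r • c = e (g c) a := by
      intro a
      obtain ⟨r, hr⟩ := hbij.2 ((Finsupp.lapply a : (P →₀ C) →ₗ[R] C) ∘ₗ e.toLinearMap ∘ₗ g)
      exact ⟨r, fun c => LinearMap.congr_fun hr c⟩
    choose r hr using this
    refine ⟨Finsupp.onFinset S r ?_, ?_⟩
    · intro a ha
      by_contra haS
      apply ha
      apply hbij.1
      ext c
      have := hS a haS c
      simpa [hr] using this
    · ext c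
      apply e.injective
      ext a
      change e (c ⊗ₜ _) a = _
      rw [he]
      exact hr a c
  constructor
  · intro x y hxy
    have h1 : s x = s y := by
      apply inj
      ext c
      have := congrArg (s.lTensor C) (LinearMap.congr_fun hxy c)
      simpa [muMap] using this
    have h2 := congrArg p h1
    simpa [← LinearMap.comp_apply, hps] using h2
  · intro g
    obtain ⟨f, hf⟩ := surj (s.lTensor C ∘ₗ g)
    refine ⟨p f, ?_⟩
    ext c
    have h1 := congrArg (p.lTensor C) (LinearMap.congr_fun hf c)
    have h2 : p.lTensor C (s.lTensor C (g c)) = g c := by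
      rw [← LinearMap.comp_apply, ← LinearMap.lTensor_comp, hps, LinearMap.lTensor_id]
      rfl
    rw [LinearMap.comp_apply, h2] at h1
    rw [← h1]
    simp [muMap]

theorem exists_lift (hP : ∀ n, Module.Projective R ↥(Q n)) {n : ℕ} (f : B →ₗ[R] B')
    (hf : Function.Surjective f) (g : ↥(Q n) →ₗ[R] B') : ∃ g' : ↥(Q n) →ₗ[R] B, f ∘ₗ g' = g :=
  Module.projective_lifting_property f g hf

theorem Acyc.correct (hQ : ∀ n, dQ n ∘ₗ dQ (n + 1) = 0)
    (f : B →ₗ[R] B') (hk : Acyc Q dQ (LinearMap.ker f)) {n : ℕ} (g : ↥(Q n) →ₗ[R] B)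
    (hg : f ∘ₗ g ∘ₗ dQ n = 0) :
    ∃ l : ↥(Q n) →ₗ[R] B, f ∘ₗ l = 0 ∧ (g - l) ∘ₗ dQ n = 0 := by
  obtain ⟨k, hk⟩ := hk n ((g ∘ₗ dQ n).codRestrict (LinearMap.ker f)
      (fun x => LinearMap.congr_fun hg x)) (by
    ext x
    have := LinearMap.congr_fun (hQ n) x
    simp only [LinearMap.comp_apply, LinearMap.zero_apply] at this
    change g (dQ n (dQ (n + 1) x)) = 0
    rw [this, map_zero])
  refine ⟨(LinearMap.ker f).subtype ∘ₗ k, ?_, ?_⟩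
  · ext x
    exact (k x).2
  · ext x
    have := congrArg Subtype.val (LinearMap.congr_fun hk x)
    change g (dQ n x) = k (dQ n x) at this
    simp [this]

theorem Acyc.quot (hP : ∀ n, Module.Projective R ↥(Q n)) (hQ : ∀ n, dQ n ∘ₗ dQ (n + 1) = 0)
    (f : B →ₗ[R] B') (hf : Function.Surjective f)
    (hk : Acyc Q dQ (LinearMap.ker f)) (hB : Acyc Q dQ B) : Acyc Q dQ B' := by
  intro n g hg
  obtain ⟨g', rfl⟩ := exists_lift hP f hf g
  obtain ⟨l, hl, hl'⟩ := Acyc.correct hQ f hk g' (by rw [← LinearMap.comp_assoc, hg])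
  obtain ⟨m, hm⟩ := hB n _ hl'
  refine ⟨f ∘ₗ m, ?_⟩
  rw [LinearMap.comp_assoc, ← hm, LinearMap.comp_sub, hl, sub_zero]

theorem Acyc.lift (hP : ∀ n, Module.Projective R ↥(Q n)) (hQ : ∀ n, dQ n ∘ₗ dQ (n + 1) = 0)
    (η : ↥(Q 0) →ₗ[R] C) (hη : Function.Surjective η) (hη0 : Function.Exact (dQ 0) η)
    (f : B →ₗ[R] B') (hf : Function.Surjective f)
    (hk : Acyc Q dQ (LinearMap.ker f)) (g : C →ₗ[R] B') : ∃ g' : C →ₗ[R] B, f ∘ₗ g' = g := by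
  obtain ⟨g', hg'⟩ := exists_lift hP f hf (g ∘ₗ η)
  have hc : η ∘ₗ dQ 0 = 0 := by
    ext x
    exact hη0.apply_apply_eq_zero x
  obtain ⟨l, hl, hl'⟩ := Acyc.correct hQ f hk g' (by
    rw [← LinearMap.comp_assoc, hg', LinearMap.comp_assoc, hc, LinearMap.comp_zero])
  have hle : LinearMap.ker η ≤ LinearMap.ker (g' - l) := by
    intro x hx
    obtain ⟨y, rfl⟩ := (hη0 x).1 hx
    exact LinearMap.congr_fun hl' y
  let m : C →ₗ[R] B := (LinearMap.ker η).liftQ (g' - l) hle ∘ₗ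
    (η.quotKerEquivOfSurjective hη).symm.toLinearMap
  have hm : ∀ x, m (η x) = (g' - l) x := by
    intro x
    have : (η.quotKerEquivOfSurjective hη).symm (η x) = (LinearMap.ker η).mkQ x := by
      rw [LinearEquiv.symm_apply_eq]; rfl
    simp only [m, LinearMap.comp_apply, LinearEquiv.coe_coe, this]
    rfl
  refine ⟨m, ?_⟩
  ext c
  obtain ⟨x, rfl⟩ := hη c
  have h1 := LinearMap.congr_fun hg' x
  have h2 := LinearMap.congr_fun hl x
  simp only [LinearMap.comp_apply, LinearMap.zero_apply] at h1 h2
  simp [hm, h1, h2]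

/-- exactness is detected by `Hom(C, -)` -/
theorem exact_step [Module.Finite R C] (hfaith : ∀ r : R, (∀ c : C, r • c = 0) → r = 0)
    (hP : ∀ n, Module.Projective R ↥(Q n)) (hQ : ∀ n, dQ n ∘ₗ dQ (n + 1) = 0)
    (η : ↥(Q 0) →ₗ[R] C) (hη : Function.Surjective η) (hη0 : Function.Exact (dQ 0) η)
    {X Y Z : Type} [AddCommGroup X] [Module R X] [AddCommGroup Y] [Module R Y]
    [AddCommGroup Z] [Module R Z] (f : X →ₗ[R] Y) (g : Y →ₗ[R] Z) (hgf : g ∘ₗ f = 0)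
    (hacyc : Acyc Q dQ (LinearMap.range f))
    (hhom : ∀ h : C →ₗ[R] Y, g ∘ₗ h = 0 → ∃ l : C →ₗ[R] X, h = f ∘ₗ l) :
    Function.Exact f g := by
  let K := LinearMap.ker g
  let f' : X →ₗ[R] K := f.codRestrict K (fun x => LinearMap.congr_fun hgf x)
  let q := (LinearMap.range f').mkQ
  have hker : Acyc Q dQ (LinearMap.ker q) := by
    have hmem : ∀ x : LinearMap.ker q, K.subtype x.1 ∈ LinearMap.range f := by
      rintro ⟨x, hx⟩
      rw [Submodule.ker_mkQ] at hx
      obtain ⟨y, rfl⟩ := hx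
      exact ⟨y, rfl⟩
    have hmem2 : ∀ x : LinearMap.range f, g x = 0 := by
      rintro ⟨x, y, rfl⟩
      exact LinearMap.congr_fun hgf y
    refine Acyc.retract (B' := LinearMap.range f)
      ((K.subtype ∘ₗ (LinearMap.ker q).subtype).codRestrict _ hmem)
      (((LinearMap.range f).subtype.codRestrict K hmem2).codRestrict (LinearMap.ker q) ?_) ?_ hacyc
    · rintro ⟨x, y, rfl⟩
      rw [Submodule.ker_mkQ]
      exact ⟨y, rfl⟩
    · ext x
      rfl
  have hz : ∀ x : K ⧸ LinearMap.range f', x = 0 := by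
    apply subsingleton_of_hom_eq_zero C hfaith
    intro h
    obtain ⟨h', rfl⟩ := Acyc.lift hP hQ η hη hη0 q (Submodule.mkQ_surjective _) hker h
    obtain ⟨l, hl⟩ := hhom (K.subtype ∘ₗ h') (by
      ext c
      exact (h' c).2)
    ext c
    change (LinearMap.range f').mkQ (h' c) = 0
    rw [Submodule.mkQ_apply, Submodule.Quotient.mk_eq_zero]
    refine ⟨l c, Subtype.ext ?_⟩
    exact (LinearMap.congr_fun hl c).symm
  intro y
  constructor
  · intro hy
    have := hz (q ⟨y, hy⟩)
    rw [Submodule.mkQ_apply, Submodule.Quotient.mk_eq_zero] at this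
    obtain ⟨x, hx⟩ := this
    exact ⟨x, congrArg Subtype.val hx⟩
  · rintro ⟨x, rfl⟩
    exact LinearMap.congr_fun hgf x

theorem acyc_step (hP : ∀ n, Module.Projective R ↥(Q n)) (hQ : ∀ n, dQ n ∘ₗ dQ (n + 1) = 0)
    {X Y Z : Type} [AddCommGroup X] [Module R X] [AddCommGroup Y] [Module R Y]
    [AddCommGroup Z] [Module R Z] (f : X →ₗ[R] Y) (g : Y →ₗ[R] Z) (hfg : Function.Exact f g)
    (hacyc : Acyc Q dQ (LinearMap.range f)) (hY : Acyc Q dQ Y) :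
    Acyc Q dQ (LinearMap.range g) := by
  refine Acyc.quot hP hQ g.rangeRestrict g.surjective_rangeRestrict ?_ hY
  rw [LinearMap.ker_rangeRestrict, hfg.linearMap_ker_eq]
  exact hacyc

theorem acyc_of_subsingleton [Subsingleton B] : Acyc Q dQ B :=
  fun _ _ _ => ⟨0, by ext; exact Subsingleton.elim _ _⟩

end AcycPart

/-- If `M` admits a bounded augmented proper `P_C`-projective resolution,
then `M` belongs to the Bass class `B_C`. -/
theorem memBassClass_of_bounded_augProperRes
    (R : Type) [CommRing R] (C : Type) [AddCommGroup C] [Module R C]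
    (M : Type) [AddCommGroup M] [Module R M] (hC : IsSemidualizing R C)
    (P : ℕ → ModuleCat.{0} R)
    (d : ∀ k : ℕ, (C ⊗[R] ↥(P (k + 1))) →ₗ[R] (C ⊗[R] ↥(P k)))
    (ε : (C ⊗[R] ↥(P 0)) →ₗ[R] M)
    (hX : IsAugProperRes R C M P d ε)
    (hbd : ∃ n : ℕ, ∀ i, n < i → Subsingleton (C ⊗[R] ↥(P i))) :
    MemBassClass R C M := by
  obtain ⟨⟨Q, dQ, η, hQfin, hQproj, hη, hη0, hQex⟩, hbij, hExt⟩ := hC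
  obtain ⟨hPproj, hdd, hεd, hprop⟩ := hX
  obtain ⟨n, hn⟩ := hbd
  have hfinC : Module.Finite R C := Module.Finite.of_surjective η hη
  have hQ : ∀ n, dQ n ∘ₗ dQ (n + 1) = 0 := by
    intro n
    ext x
    exact (hQex n).apply_apply_eq_zero x
  have hfaith : ∀ r : R, (∀ c : C, r • c = 0) → r = 0 := by
    intro r hr
    apply hbij.1
    ext c
    simpa using hr c
  have hCac : Acyc Q dQ C := fun i =>
    (ext_iff_acyc C Q dQ η hQproj hη hη0 hQex C i).1 (hExt (i + 1) (by omega))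
  -- Hom(C,-) exactness
  obtain ⟨hS, hE0, hE⟩ := hprop R inferInstance
  let e := TensorProduct.rid R C
  have hS' : ∀ g : C →ₗ[R] M, ∃ h : C →ₗ[R] (C ⊗[R] ↥(P 0)), g = ε ∘ₗ h := by
    intro g
    obtain ⟨h, hh⟩ := hS (g ∘ₗ e.toLinearMap)
    refine ⟨h ∘ₗ e.symm.toLinearMap, ?_⟩
    ext c
    have := LinearMap.congr_fun hh (e.symm c)
    simpa using this.symm
  have hE0' : ∀ g : C →ₗ[R] (C ⊗[R] ↥(P 0)), ε ∘ₗ g = 0 →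
      ∃ h : C →ₗ[R] (C ⊗[R] ↥(P 1)), g = d 0 ∘ₗ h := by
    intro g hg
    obtain ⟨h, hh⟩ := (hE0 (g ∘ₗ e.toLinearMap)).1 (by
      change ε ∘ₗ (g ∘ₗ e.toLinearMap) = 0
      rw [← LinearMap.comp_assoc, hg, LinearMap.zero_comp])
    refine ⟨h ∘ₗ e.symm.toLinearMap, ?_⟩
    ext c
    have := LinearMap.congr_fun hh (e.symm c)
    simpa using this.symm
  have hE' : ∀ n, ∀ g : C →ₗ[R] (C ⊗[R] ↥(P (n + 1))), d n ∘ₗ g = 0 →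
      ∃ h : C →ₗ[R] (C ⊗[R] ↥(P (n + 2))), g = d (n + 1) ∘ₗ h := by
    intro n g hg
    obtain ⟨h, hh⟩ := (hE n (g ∘ₗ e.toLinearMap)).1 (by
      change d n ∘ₗ (g ∘ₗ e.toLinearMap) = 0
      rw [← LinearMap.comp_assoc, hg, LinearMap.zero_comp])
    refine ⟨h ∘ₗ e.symm.toLinearMap, ?_⟩
    ext c
    have := LinearMap.congr_fun hh (e.symm c)
    simpa using this.symm
  have hPac : ∀ k, Acyc Q dQ (C ⊗[R] ↥(P k)) := fun k => by
    have := hPproj k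
    exact hCac.tensor hQfin _
  -- exactness of the complex
  have hmain : ∀ j k, n < k + j →
      Acyc Q dQ (LinearMap.range (d k)) ∧ Function.Exact (d (k + 1)) (d k) := by
    intro j
    induction j with
    | zero =>
      intro k hk
      have h1 : Subsingleton (C ⊗[R] ↥(P (k + 1))) := hn _ (by omega)
      constructor
      · have : Subsingleton (LinearMap.range (d k)) := (d k).surjective_rangeRestrict.subsingleton
        exact acyc_of_subsingleton
      · intro y
        exact ⟨fun _ => ⟨0, Subsingleton.elim _ _⟩, fun _ => by
          rw [Subsingleton.elim y 0, map_zero]⟩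
    | succ j ih =>
      intro k hk
      obtain ⟨h1, -⟩ := ih (k + 1) (by omega)
      have h2 := exact_step hfaith hQproj hQ η hη hη0 _ _ (hdd k) h1 (hE' k)
      exact ⟨acyc_step hQproj hQ _ _ h2 h1 (hPac _), h2⟩
  have hex : ∀ k, Function.Exact (d (k + 1)) (d k) := fun k => (hmain (n + 1) k (by omega)).2
  have hr0 : Acyc Q dQ (LinearMap.range (d 0)) := (hmain (n + 1) 0 (by omega)).1
  have hex0 : Function.Exact (d 0) ε := exact_step hfaith hQproj hQ η hη hη0 _ _ hεd hr0 hE0'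
  have hrε : Acyc Q dQ (LinearMap.range ε) := acyc_step hQproj hQ _ _ hex0 hr0 (hPac 0)
  have hεsurj : Function.Surjective ε := by
    have h1 : Function.Exact ε (0 : M →ₗ[R] M) :=
      exact_step hfaith hQproj hQ η hη hη0 _ _ (LinearMap.zero_comp _) hrε (fun h _ => hS' h)
    intro m
    exact (h1 m).1 rfl
  have hMac : Acyc Q dQ M := by
    refine Acyc.retract (LinearMap.id.codRestrict (LinearMap.range ε) (fun m => hεsurj m))
      (LinearMap.range ε).subtype ?_ hrε
    ext m
    rfl
  -- the projective resolution of Hom(C, M)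
  have hmu : ∀ k, Function.Bijective (muMap R C ↥(P k)) := fun k => by
    have := hPproj k
    exact mu_bijective hbij _
  let m : ∀ k, ↥(P k) ≃ₗ[R] (C →ₗ[R] C ⊗[R] ↥(P k)) := fun k =>
    LinearEquiv.ofBijective (muMap R C ↥(P k)) (hmu k)
  have hm : ∀ k p c, m k p c = c ⊗ₜ p := fun _ _ _ => rfl
  let δ : ∀ k, ↥(P (k + 1)) →ₗ[R] ↥(P k) := fun k =>
    (m k).symm.toLinearMap ∘ₗ (LinearMap.llcomp R C _ _ (d k)) ∘ₗ (m (k + 1)).toLinearMap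
  have hδ : ∀ k p, m k (δ k p) = d k ∘ₗ m (k + 1) p := by
    intro k p
    exact (m k).apply_symm_apply _
  have hδd : ∀ k, (δ k).lTensor C = d k := by
    intro k
    ext c p
    have := LinearMap.congr_fun (hδ k p) c
    simpa [hm] using this
  let ε' : ↥(P 0) →ₗ[R] (C →ₗ[R] M) := (LinearMap.llcomp R C _ _ ε) ∘ₗ (m 0).toLinearMap
  have hε' : ∀ p, ε' p = ε ∘ₗ m 0 p := fun _ => rfl
  have hε'surj : Function.Surjective ε' := by
    intro g
    obtain ⟨h, rfl⟩ := hS' g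
    exact ⟨(m 0).symm h, by rw [hε', LinearEquiv.apply_symm_apply]⟩
  have hδ0 : Function.Exact (δ 0) ε' := by
    intro p
    constructor
    · intro hp
      obtain ⟨l, hl⟩ := hE0' (m 0 p) hp
      refine ⟨(m 1).symm l, (m 0).injective ?_⟩
      rw [hδ, LinearEquiv.apply_symm_apply, hl]
    · rintro ⟨q, rfl⟩
      rw [hε', hδ, ← LinearMap.comp_assoc, hεd, LinearMap.zero_comp]
  have hδex : ∀ k, Function.Exact (δ (k + 1)) (δ k) := by
    intro k p
    constructor
    · intro hp
      obtain ⟨l, hl⟩ := hE' k (m (k + 1) p) (by rw [← hδ, hp, map_zero])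
      refine ⟨(m (k + 2)).symm l, (m (k + 1)).injective ?_⟩
      rw [hδ, LinearEquiv.apply_symm_apply, hl]
    · rintro ⟨q, rfl⟩
      apply (m k).injective
      rw [hδ, hδ, ← LinearMap.comp_assoc, hdd, LinearMap.zero_comp, map_zero]
  have hν : ∀ y, evalNu R C M (ε'.lTensor C y) = ε y := by
    intro y
    have : evalNu R C M ∘ₗ ε'.lTensor C = ε := by
      ext c p
      simp [evalNu, hε', hm]
    exact LinearMap.congr_fun this y
  refine ⟨?_, ?_, ?_, ?_⟩
  · intro i hi
    obtain ⟨i, rfl⟩ := Nat.exists_eq_add_of_le' hi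
    exact (ext_iff_acyc C Q dQ η hQproj hη hη0 hQex M i).2 (hMac i)
  · intro i hi
    obtain ⟨i, rfl⟩ := Nat.exists_eq_add_of_le' hi
    refine tor_zero _ P δ ε' hPproj hε'surj hδ0 hδex C i ?_
    rw [hδd, hδd]
    exact hex i
  · rw [injective_iff_map_eq_zero]
    intro x hx
    obtain ⟨y, rfl⟩ := LinearMap.lTensor_surjective C hε'surj x
    rw [hν] at hx
    obtain ⟨z, rfl⟩ := (hex0 y).1 hx
    rw [← hδd, ← LinearMap.comp_apply, ← LinearMap.lTensor_comp]
    have : ε' ∘ₗ δ 0 = 0 := by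
      ext1 q
      exact hδ0.apply_apply_eq_zero q
    rw [this, LinearMap.lTensor_zero, LinearMap.zero_apply]
  · intro x
    obtain ⟨y, rfl⟩ := hεsurj x
    exact ⟨_, hν y⟩

end
end
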